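/- Let t = 2t' be an even positive integer and n a positive integer. Then Σ_{λ ∈ DD, |λ| = tn, #H_t(λ) = n} δ_λ ∏_{h ∈ H_t(λ)} t/(h ε_h) equals the coefficient of x^{t'n} in the power series exp(-x^{t'} - t x^t / 2), where the sum ranges over doubled distinct partitions of tn having exactly n hook lengths divisible by t. Moreover, if t = 2t'+1 is an odd positive integer, then Σ_{λ ∈ SC, |λ| = tn, #H_t(λ) = n} δ_λ ∏_{h ∈ H_t(λ)} t/(h ε_h) equals the coefficient of x^{tn} in exp(-x^t - t x^{2t}/2), where the sum ranges over self-conjugate partitions of tn having exactly n hook lengths divisible by t. -/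

import Mathlib

/-!
Statement 17 (Corollary `corfin1`): for any positive integer `n`:
if `t = 2t'` is an even positive integer, then
Σ_{λ ∈ DD, |λ| = tn, #H_t(λ) = n} δ_λ ∏_{h ∈ H_t(λ)} t/(h ε_h)
  = [x^{t'n}] exp(-x^{t'} - t x^t / 2);
and if `t = 2t'+1` is an odd positive integer, then
Σ_{λ ∈ SC, |λ| = tn, #H_t(λ) = n} δ_λ ∏_{h ∈ H_t(λ)} t/(h ε_h)
  = [x^{tn}] exp(-x^t - t x^{2t}/2),
where `exp` is the exponential power series over ℚ.
-/

noncomputable section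

open PowerSeries

/-- Product (pi) topology on formal power series. -/
instance {R : Type*} [TopologicalSpace R] : TopologicalSpace (PowerSeries R) :=
  inferInstanceAs (TopologicalSpace ((Unit →₀ ℕ) → R))

/-- The hook length of the box `c = (i, j)` (0-indexed) of a Young diagram. -/
def hookLen (μ : YoungDiagram) (c : ℕ × ℕ) : ℕ :=
  μ.rowLen c.1 + μ.colLen c.2 - c.1 - c.2 - 1

/-- The Durfee length: the number of diagonal cells. -/
def durfee (μ : YoungDiagram) : ℕ :=
  (μ.cells.filter fun c => c.1 = c.2).card

/-- `ε` of a box: `-1` if strictly above the principal diagonal, `1` otherwise. -/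
def epsQ (c : ℕ × ℕ) : ℚ := if c.2 < c.1 then (-1 : ℚ) else 1

/-- A Young diagram is doubled distinct if, in Frobenius coordinates,
`a_i = b_i + 1` for every diagonal cell. -/
def DDiagram (μ : YoungDiagram) : Prop :=
  ∀ i : ℕ, (i, i) ∈ μ → μ.rowLen i = μ.colLen i + 1

/-- The formal exponential `exp f = Σ_k f^k / k!` of a power series over ℚ. -/
def pexpQ (f : PowerSeries ℚ) : PowerSeries ℚ :=
  ∑' k : ℕ, PowerSeries.C ((k.factorial : ℚ))⁻¹ * f ^ k

/-! ### The exponential side -/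

namespace HF

theorem pexpQ_coeff (f : PowerSeries ℚ) (hf : PowerSeries.constantCoeff f = 0) (m : ℕ) :
    PowerSeries.coeff m (pexpQ f) =
      ∑ k ∈ Finset.range (m + 1), ((k.factorial : ℚ))⁻¹ * PowerSeries.coeff m (f ^ k) := by
  have hz : ∀ m k : ℕ, m < k → PowerSeries.coeff m (f ^ k) = 0 := by
    intro m k hk
    have : (X : PowerSeries ℚ) ∣ f := PowerSeries.X_dvd_iff.2 hf
    exact PowerSeries.X_pow_dvd_iff.1 (pow_dvd_pow_of_dvd this k) m hk
  have hs : HasSum (fun k : ℕ => PowerSeries.C ((k.factorial : ℚ))⁻¹ * f ^ k)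
      (PowerSeries.mk fun m => ∑ k ∈ Finset.range (m + 1),
        ((k.factorial : ℚ))⁻¹ * PowerSeries.coeff m (f ^ k)) := by
    refine (Pi.hasSum (X := fun _ : Unit →₀ ℕ => ℚ)).2 ?_
    intro x
    obtain ⟨m, rfl⟩ : ∃ m, x = Finsupp.single () m := ⟨x (), by ext; simp⟩
    have h1 : ∀ k : ℕ, (PowerSeries.C ((k.factorial : ℚ))⁻¹ * f ^ k) (Finsupp.single () m)
        = ((k.factorial : ℚ))⁻¹ * PowerSeries.coeff m (f ^ k) := by
      intro k
      rw [← PowerSeries.coeff_C_mul]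
      rfl
    have h2 : (PowerSeries.mk fun m => ∑ k ∈ Finset.range (m + 1),
        ((k.factorial : ℚ))⁻¹ * PowerSeries.coeff m (f ^ k)) (Finsupp.single () m)
        = ∑ k ∈ Finset.range (m + 1), ((k.factorial : ℚ))⁻¹ * PowerSeries.coeff m (f ^ k) := by
      exact PowerSeries.coeff_mk (R := ℚ) m (fun m => ∑ k ∈ Finset.range (m + 1),
        ((k.factorial : ℚ))⁻¹ * PowerSeries.coeff m (f ^ k))
    simp only [h1, h2]
    apply hasSum_sum_of_ne_finset_zero
    intro k hk
    rw [hz m k (by simpa using hk), mul_zero]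
  have : T2Space (PowerSeries ℚ) := inferInstanceAs (T2Space ((Unit →₀ ℕ) → ℚ))
  rw [pexpQ, hs.tsum_eq, PowerSeries.coeff_mk]

open Polynomial in
/-- The coefficients of `exp (-y - c y^2)`. -/
def eCoeff (c : ℚ) (n : ℕ) : ℚ :=
  ∑ k ∈ Finset.range (n + 1), ((k.factorial : ℚ))⁻¹ *
    ((- Polynomial.X - Polynomial.C c * Polynomial.X ^ 2 : Polynomial ℚ) ^ k).coeff n

open Polynomial in
theorem gcoeff_zero (c : ℚ) (n k : ℕ) (h : n < k) :
    ((- Polynomial.X - Polynomial.C c * Polynomial.X ^ 2 : Polynomial ℚ) ^ k).coeff n = 0 := by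
  have : (- Polynomial.X - Polynomial.C c * Polynomial.X ^ 2 : Polynomial ℚ)
      = Polynomial.X * (-1 - Polynomial.C c * Polynomial.X) := by ring
  rw [this, mul_pow, Polynomial.coeff_X_pow_mul', if_neg (by omega)]

theorem eCoeff_ext (c : ℚ) (n m : ℕ) (h : n < m) : eCoeff c n =
  ∑ k ∈ Finset.range m, ((k.factorial : ℚ))⁻¹ *
    ((- Polynomial.X - Polynomial.C c * Polynomial.X ^ 2 : Polynomial ℚ) ^ k).coeff n := by
  rw [eCoeff]
  apply Finset.sum_subset
  · intro x; simp; omega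
  · intro x _ hx
    rw [gcoeff_zero _ _ _ (by simpa using hx), mul_zero]

theorem pexp_expand (a : ℕ) (ha : 0 < a) (c : ℚ) (n : ℕ) :
    PowerSeries.coeff (a * n) (pexpQ (- X ^ a - PowerSeries.C c * X ^ (2 * a))) = eCoeff c n := by
  have hf : (- X ^ a - PowerSeries.C c * X ^ (2 * a) : PowerSeries ℚ) =
    ((Polynomial.expand ℚ a (- Polynomial.X - Polynomial.C c * Polynomial.X ^ 2) : Polynomial ℚ)
      : PowerSeries ℚ) := by
    simp only [map_sub, map_neg, map_mul, Polynomial.expand_X, Polynomial.expand_C, map_pow,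
      Polynomial.coe_sub, Polynomial.coe_neg, Polynomial.coe_mul, Polynomial.coe_pow,
      Polynomial.coe_X, Polynomial.coe_C, ← pow_mul]
    rw [mul_comm a 2]
  rw [pexpQ_coeff]
  · rw [eCoeff_ext c n (a * n + 1) (by nlinarith)]
    apply Finset.sum_congr rfl
    intro k _
    rw [hf, ← Polynomial.coe_pow, ← map_pow, Polynomial.coeff_coe, mul_comm a n,
      Polynomial.coeff_expand_mul ha]
  · simp [ha.ne']

theorem eCoeff_zero (c : ℚ) : eCoeff c 0 = 1 := by simp [eCoeff]

theorem eCoeff_succ (c : ℚ) (n : ℕ) :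
    ((n : ℚ) + 1) * eCoeff c (n + 1) + eCoeff c n
      + 2 * c * (if n = 0 then 0 else eCoeff c (n - 1)) = 0 := by
  set g := (- Polynomial.X - Polynomial.C c * Polynomial.X ^ 2 : Polynomial ℚ) with hg
  have h1 : ((n : ℚ) + 1) * eCoeff c (n + 1) =
      ∑ k ∈ Finset.range (n + 1), ((k.factorial : ℚ))⁻¹ *
        (g ^ k * Polynomial.derivative g).coeff n := by
    rw [eCoeff, Finset.sum_range_succ', mul_add, Finset.mul_sum]
    have : (g ^ 0).coeff (n + 1) = 0 := by
      rw [pow_zero, Polynomial.coeff_one, if_neg (by omega)]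
    rw [this]
    simp only [mul_zero, add_zero]
    apply Finset.sum_congr rfl
    intro k _
    have := Polynomial.coeff_derivative (g ^ (k + 1)) n
    rw [Polynomial.derivative_pow_succ, mul_assoc, Polynomial.coeff_C_mul] at this
    rw [Nat.factorial_succ]
    push_cast
    have hk : (k.factorial : ℚ) ≠ 0 := by positivity
    have hk' : (k : ℚ) + 1 ≠ 0 := by positivity
    rw [mul_inv]
    calc _ = (((k : ℚ) + 1)⁻¹ * (k.factorial : ℚ)⁻¹) * ((g ^ (k + 1)).coeff (n + 1) * (n + 1)) := by
          ring
      _ = _ := by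
        rw [← this]
        field_simp
  have hd : Polynomial.derivative g = -1 - Polynomial.C (2 * c) * Polynomial.X := by
    rw [hg]
    simp [Polynomial.derivative_pow]
    ring_nf
  have h2 : ∀ k, (g ^ k * Polynomial.derivative g).coeff n
      = - (g ^ k).coeff n - 2 * c * (if n = 0 then 0 else (g ^ k).coeff (n - 1)) := by
    intro k
    rw [hd, mul_sub, Polynomial.coeff_sub, mul_left_comm, Polynomial.coeff_C_mul]
    cases n with
    | zero => simp
    | succ n => simp
  rw [h1]
  simp only [h2, mul_sub, Finset.sum_sub_distrib]
  rw [eCoeff]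
  split_ifs with h0
  · simp [← hg]
  · rw [eCoeff_ext c (n - 1) (n + 1) (by omega), Finset.mul_sum]
    simp only [mul_neg, Finset.sum_neg_distrib, ← hg]
    have : ∀ x : ℕ, (x.factorial : ℚ)⁻¹ * (2 * c * (g ^ x).coeff (n - 1)) =
      2 * c * ((x.factorial : ℚ)⁻¹ * (g ^ x).coeff (n - 1)) := fun x => by ring
    simp only [this]
    ring

/-- Uniqueness of the solution of the recurrence. -/
theorem rec_unique (c : ℚ) (n : ℕ) (a : ℕ → ℚ) (h0 : a 0 = 1)
    (h : ∀ j < n, ((j : ℚ) + 1) * a (j + 1) + a j + 2 * c * (if j = 0 then 0 else a (j - 1)) = 0) :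
    a n = eCoeff c n := by
  have : ∀ m ≤ n, a m = eCoeff c m := by
    intro m
    induction m using Nat.strong_induction_on with
    | _ m ih =>
      intro hm
      cases m with
      | zero => rw [h0, eCoeff_zero]
      | succ j =>
        have e1 := h j (by omega)
        have e2 := eCoeff_succ c j
        rw [ih j (by omega) (by omega)] at e1
        have e3 : (if j = 0 then 0 else a (j - 1)) = (if j = 0 then 0 else eCoeff c (j - 1)) := by
          split_ifs with hj
          · rfl
          · exact ih _ (by omega) (by omega)
        rw [e3] at e1
        have : ((j : ℚ) + 1) * a (j + 1) = ((j : ℚ) + 1) * eCoeff c (j + 1) := by linarith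
        exact mul_left_cancel₀ (by positivity) this
  exact this n le_rfl

end HF

/-! ### The determinant and its differential equation -/
namespace HF

/-- Complete homogeneous symbols: `∑ hh t m z^m = exp (x z^t)`. -/
def hh (t : ℕ) (m : ℤ) : PowerSeries ℚ :=
  if 0 ≤ m ∧ (t : ℤ) ∣ m then PowerSeries.monomial (m.toNat / t) (((m.toNat / t).factorial : ℚ))⁻¹
  else 0

theorem hh_mul (t : ℕ) (ht : 0 < t) (q : ℕ) :
    hh t (t * q) = PowerSeries.monomial q ((q.factorial : ℚ))⁻¹ := by
  have : ((t : ℤ) * q).toNat = t * q := by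
    rw [← Nat.cast_mul, Int.toNat_natCast]
  rw [hh, if_pos ⟨by positivity, dvd_mul_right _ _⟩, this, Nat.mul_div_cancel_left _ ht]

theorem hh_not (t : ℕ) (m : ℤ) (h : ∀ q : ℕ, m ≠ t * q) : hh t m = 0 := by
  rw [hh, if_neg]
  rintro ⟨h0, q, rfl⟩
  rcases Nat.eq_zero_or_pos t with rfl | ht
  · exact h 0 (by simp)
  · have : 0 ≤ q := by
      have : (0 : ℤ) < t := by exact_mod_cast ht
      by_contra hq
      nlinarith
    lift q to ℕ using this
    exact h q rfl

theorem hh_neg (t : ℕ) (m : ℤ) (h : m < 0) : hh t m = 0 := by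
  apply hh_not
  intro q hq
  have : (0 : ℤ) ≤ t * q := by positivity
  omega

theorem hh_derivative (t : ℕ) (ht : 0 < t) (m : ℤ) :
    PowerSeries.derivative ℚ (hh t m) = hh t (m - t) := by
  by_cases h : ∃ q : ℕ, m = t * q
  · obtain ⟨q, rfl⟩ := h
    cases q with
    | zero =>
      rw [hh_neg t ((t : ℤ) * ((0 : ℕ) : ℤ) - t) (by simpa using ht), hh_mul t ht]
      ext n
      rw [PowerSeries.coeff_derivative, PowerSeries.coeff_monomial]
      simp
    | succ q =>
      have : (t : ℤ) * ((q + 1 : ℕ) : ℤ) - t = t * q := by push_cast; ring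
      rw [this, hh_mul t ht, hh_mul t ht]
      ext n
      rw [PowerSeries.coeff_derivative, PowerSeries.coeff_monomial, PowerSeries.coeff_monomial]
      by_cases hn : n = q
      · subst hn
        simp only [if_true]
        rw [Nat.factorial_succ]
        push_cast
        have : (n : ℚ) + 1 ≠ 0 := by positivity
        field_simp
      · rw [if_neg (by omega), if_neg hn, zero_mul]
  · push Not at h
    rw [hh_not t m h, map_zero, hh_not]
    intro q hq
    apply h (q + 1)
    push_cast
    linarith

theorem hh_dvd (t : ℕ) (ht : 0 < t) (m : ℕ) (s : ℤ) (h : (t : ℤ) * m ≤ s) :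
    (X : PowerSeries ℚ) ^ m ∣ hh t s := by
  by_cases hq : ∃ q : ℕ, s = t * q
  · obtain ⟨q, rfl⟩ := hq
    have : m ≤ q := by
      have h1 : (t : ℤ) * m ≤ t * q := h
      have h2 : (0 : ℤ) < t := by exact_mod_cast ht
      exact_mod_cast le_of_mul_le_mul_left h1 h2
    rw [hh_mul t ht, PowerSeries.X_pow_dvd_iff]
    intro k hk
    rw [PowerSeries.coeff_monomial, if_neg (by omega)]
  · push Not at hq
    rw [hh_not t s hq]
    exact dvd_zero _

/-- The coefficients of the column relation. -/
def alt (j : ℕ) : PowerSeries ℚ := PowerSeries.monomial j ((-1) ^ j * ((j.factorial : ℚ))⁻¹)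

theorem alt_sum (q : ℕ) (hq : 0 < q) :
    ∑ j ∈ Finset.range (q + 1), (-1 : ℚ) ^ j * ((j.factorial : ℚ))⁻¹ * (((q - j).factorial : ℚ))⁻¹
      = 0 := by
  have h := Int.alternating_sum_range_choose_of_ne (n := q) hq.ne'
  have h' : ∑ j ∈ Finset.range (q + 1), (-1 : ℚ) ^ j * (q.choose j : ℚ) = 0 := by
    exact_mod_cast h
  have hf : (q.factorial : ℚ) ≠ 0 := by positivity
  apply mul_left_cancel₀ hf
  rw [mul_zero, ← h', Finset.mul_sum]
  apply Finset.sum_congr rfl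
  intro j hj
  rw [Nat.cast_choose ℚ (by simpa [Nat.lt_succ_iff] using hj)]
  field_simp

theorem hh_column (t : ℕ) (ht : 0 < t) (m : ℕ) (s : ℤ) (hs : 0 < s) :
    (X : PowerSeries ℚ) ^ m ∣ ∑ j ∈ Finset.range (m + 1), alt j * hh t (s - t * j) := by
  by_cases hq : ∃ q : ℕ, s = t * q
  · obtain ⟨q, rfl⟩ := hq
    have hq0 : 0 < q := by
      rcases Nat.eq_zero_or_pos q with rfl | h
      · simp at hs
      · exact h
    have hterm : ∀ j : ℕ, alt j * hh t ((t : ℤ) * q - t * j) =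
        if j ≤ q then PowerSeries.monomial q
          ((-1 : ℚ) ^ j * ((j.factorial : ℚ))⁻¹ * (((q - j).factorial : ℚ))⁻¹) else 0 := by
      intro j
      split_ifs with hj
      · have : (t : ℤ) * q - t * j = t * ((q - j : ℕ) : ℤ) := by
          rw [Nat.cast_sub hj]; ring
        rw [this, hh_mul t ht, alt, PowerSeries.monomial_mul_monomial]
        congr 1
        rw [Nat.add_sub_cancel' hj]
      · rw [hh_neg, mul_zero]
        have : (0 : ℤ) < t := by exact_mod_cast ht
        have : (q : ℤ) < j := by exact_mod_cast (not_le.1 hj)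
        nlinarith
    rcases le_or_gt q m with hqm | hqm
    · have : ∑ j ∈ Finset.range (m + 1), alt j * hh t ((t : ℤ) * q - t * j) = 0 := by
        rw [← Finset.sum_subset (s₁ := Finset.range (q + 1))]
        · rw [Finset.sum_congr rfl (g := fun j => PowerSeries.monomial q
            ((-1 : ℚ) ^ j * ((j.factorial : ℚ))⁻¹ * (((q - j).factorial : ℚ))⁻¹))]
          · rw [← map_sum, alt_sum q hq0, map_zero]
          · intro j hj
            rw [hterm, if_pos (by simpa [Nat.lt_succ_iff] using hj)]
        · intro x; simp; omega
        · intro x _ hx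
          rw [hterm, if_neg (by simpa using hx)]
      rw [this]
      exact dvd_zero _
    · apply Finset.dvd_sum
      intro j _
      rw [hterm]
      split_ifs
      · rw [PowerSeries.X_pow_dvd_iff]
        intro k hk
        rw [PowerSeries.coeff_monomial, if_neg (by omega)]
      · exact dvd_zero _
  · push Not at hq
    rw [Finset.sum_eq_zero]
    · exact dvd_zero _
    · intro j _
      rw [hh_not, mul_zero]
      intro q h
      apply hq (q + j)
      push_cast
      linarith

section det
set_option linter.unusedSectionVars false
variable {ι R : Type*} [Fintype ι] [DecidableEq ι] [CommRing R]

theorem det_updateRow_adj (M A : Matrix ι ι R) (i : ι) :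
    (M.updateRow i (A i)).det = ∑ j, A i j * M.adjugate j i := by
  rw [Matrix.det_eq_sum_mul_adjugate_row _ i]
  apply Finset.sum_congr rfl
  intro j _
  rw [Matrix.updateRow_self, Matrix.adjugate_apply, Matrix.adjugate_apply,
    Matrix.updateRow_idem]

theorem sum_updateRow_eq (M A : Matrix ι ι R) :
    ∑ i, (M.updateRow i (A i)).det = ∑ j, (M.updateCol j (fun i => A i j)).det := by
  have h2 : ∀ j, (M.updateCol j (fun i => A i j)).det = ∑ i, A i j * M.adjugate j i := by
    intro j
    have := det_updateRow_adj M.transpose A.transpose j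
    rw [Matrix.updateRow_transpose, Matrix.det_transpose, ← Matrix.adjugate_transpose] at this
    exact this
  simp only [det_updateRow_adj, h2]
  exact Finset.sum_comm

theorem derivation_prod {S : Type*} [CommRing S] [Algebra S R] (D : Derivation S R R)
    (s : Finset ι) (f : ι → R) :
    D (∏ i ∈ s, f i) = ∑ i ∈ s, (∏ j ∈ s.erase i, f j) * D (f i) := by
  induction s using Finset.induction_on with
  | empty => simp
  | insert a s ha ih =>
    rw [Finset.prod_insert ha, D.leibniz, ih, Finset.sum_insert ha, Finset.erase_insert ha,
      smul_eq_mul, smul_eq_mul, Finset.mul_sum, add_comm]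
    congr 1
    apply Finset.sum_congr rfl
    intro i hi
    have hia : a ≠ i := by rintro rfl; exact ha hi
    rw [Finset.erase_insert_of_ne hia, Finset.prod_insert (by simp [ha]), mul_assoc]

theorem derivation_det {S : Type*} [CommRing S] [Algebra S R] (D : Derivation S R R)
    (M : Matrix ι ι R) :
    D M.det = ∑ i, (M.updateRow i (fun j => D (M i j))).det := by
  simp only [Matrix.det_apply', map_sum]
  conv_rhs => rw [Finset.sum_comm]
  apply Finset.sum_congr rfl
  intro σ _
  have hs : D (((Equiv.Perm.sign σ : ℤ) : R)) = 0 := D.map_intCast _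
  rw [D.leibniz, hs, smul_zero, add_zero, smul_eq_mul, derivation_prod, ← Finset.mul_sum]
  congr 1
  conv_rhs => rw [← Equiv.sum_comp σ]
  apply Finset.sum_congr rfl
  intro i _
  rw [← Finset.prod_erase_mul _ _ (Finset.mem_univ i)]
  rw [Matrix.updateRow_self]
  congr 1
  apply Finset.prod_congr rfl
  intro j hj
  rw [Matrix.updateRow_ne]
  intro h
  exact (Finset.ne_of_mem_erase hj) (σ.injective h)
end det

end HF

namespace HF

def MM (t : ℕ) (K : ℤ) (a k : ℤ) : PowerSeries ℚ := hh t (a - k) - hh t (K - a - k)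

def FM (t : ℕ) (K : ℤ) (N : ℕ) : Matrix (Fin N) (Fin N) (PowerSeries ℚ) :=
  fun l k => MM t K (l : ℕ) (k : ℕ)

theorem MM_anti (t : ℕ) (K a k : ℤ) : MM t K (K - a) k = - MM t K a k := by
  simp only [MM, sub_sub_cancel]; ring

section
set_option linter.unusedVariables false
theorem MM_derivative (t : ℕ) (K : ℤ) (ht : 0 < t) (a k : ℤ) : PowerSeries.derivative ℚ (MM t K a k) =
    hh t (a - t - k) - hh t (K - a - t - k) := by
  rw [MM, map_sub, hh_derivative t ht, hh_derivative t ht]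
  congr 2 <;> ring

theorem tleN (t m N : ℕ) (K : ℤ) (ht : 0 < t) (hm : 0 < m) (hN : N = t * m)
    (hK1 : 2 * (N : ℤ) ≤ K + 1) (hK2 : K ≤ 2 * N) (hpar : (2 : ℤ) ∣ K - t) : t ≤ N := by rw [hN]; exact Nat.le_mul_of_pos_right t hm

theorem lemA (t m N : ℕ) (K : ℤ) (ht : 0 < t) (hm : 0 < m) (hN : N = t * m)
    (hK1 : 2 * (N : ℤ) ≤ K + 1) (hK2 : K ≤ 2 * N) (hpar : (2 : ℤ) ∣ K - t) : ∑ i : Fin N, ((FM t K N).updateRow i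
    (fun k => MM t K ((i : ℕ) + t) (k : ℕ))).det = - (FM t K N).det := by
  have htN := tleN t m N K ht hm hN hK1 hK2 hpar
  obtain ⟨c, hc⟩ := hpar
  -- the critical row
  have hi0 : ∃ i0 : Fin N, ((i0 : ℕ) : ℤ) = c := by
    refine ⟨⟨c.toNat, by omega⟩, ?_⟩
    simp only
    omega
  obtain ⟨i0, hi0⟩ := hi0
  rw [Finset.sum_eq_single i0]
  · have : (fun k : Fin N => MM t K ((i0 : ℕ) + t) (k : ℕ)) = (-1 : PowerSeries ℚ) • (FM t K N i0) := by
      funext k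
      have h : (((i0 : ℕ) : ℤ) + t) = K - (i0 : ℕ) := by omega
      rw [h, MM_anti]
      simp [FM]
    rw [this, Matrix.det_updateRow_smul, Matrix.updateRow_eq_self]
    ring
  · intro i _ hi
    have hne : ((i : ℕ) : ℤ) ≠ c := by
      intro h
      apply hi
      ext
      omega
    have hiN := i.2
    by_cases h1 : (i : ℕ) + t < N
    · have : (fun k : Fin N => MM t K ((i : ℕ) + t) (k : ℕ)) = FM t K N ⟨i + t, h1⟩ := by
        funext k
        simp [FM]
      rw [this]
      apply Matrix.det_updateRow_eq_zero
      intro h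
      have := congrArg Fin.val h
      simp at this
      omega
    · by_cases h2 : K - ((i : ℕ) + t) = N
      · have : (fun k : Fin N => MM t K ((i : ℕ) + t) (k : ℕ)) = 0 := by
          funext k
          have h3 : K - (((i : ℕ) : ℤ) + t) = (((i : ℕ) : ℤ) + t) := by omega
          rw [MM, h3, sub_self]
          rfl
        rw [this]
        exact Matrix.det_eq_zero_of_row_eq_zero i (by simp)
      · have h3 : (K - ((i : ℕ) + t)).toNat < N := by omega
        have : (fun k : Fin N => MM t K ((i : ℕ) + t) (k : ℕ))
            = (-1 : PowerSeries ℚ) • FM t K N ⟨(K - ((i : ℕ) + t)).toNat, h3⟩ := by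
          funext k
          have h4 : (((K - ((i : ℕ) + t)).toNat : ℕ) : ℤ) = K - ((i : ℕ) + t) := by omega
          simp only [FM, Pi.smul_apply, h4, MM_anti]
          simp
        rw [this, Matrix.det_updateRow_smul, Matrix.det_updateRow_eq_zero, mul_zero]
        intro h
        have := congrArg Fin.val h
        simp at this
        omega
  · simp

theorem lemB (t m N : ℕ) (K : ℤ) (ht : 0 < t) (hm : 0 < m) (hN : N = t * m)
    (hK1 : 2 * (N : ℤ) ≤ K + 1) (hK2 : K ≤ 2 * N) (hpar : (2 : ℤ) ∣ K - t) (i : Fin N) : (X : PowerSeries ℚ) ^ m ∣ ((FM t K N).updateRow i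
    (fun k => MM t K ((i : ℕ) - t) (k : ℕ))).det := by
  have hiN := i.2
  by_cases h1 : t ≤ (i : ℕ)
  · have : (fun k : Fin N => MM t K ((i : ℕ) - t) (k : ℕ)) = FM t K N ⟨i - t, by omega⟩ := by
      funext k
      simp [FM, h1]
    rw [this, Matrix.det_updateRow_eq_zero]
    · exact dvd_zero _
    · intro h
      have := congrArg Fin.val h
      simp at this
      omega
  · rw [det_updateRow_adj _ (fun (i k : Fin N) => MM t K (((i : ℕ) : ℤ) - t) (k : ℕ))]
    apply Finset.dvd_sum
    intro k _
    apply Dvd.dvd.mul_right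
    have hk := k.2
    rw [MM, hh_neg _ _ (by omega), zero_sub, dvd_neg]
    apply hh_dvd t ht
    have : (t : ℤ) * m = N := by rw [hN]; push_cast; ring
    rw [this]
    omega

theorem lemC (t m N : ℕ) (K : ℤ) (ht : 0 < t) (hm : 0 < m) (hN : N = t * m)
    (hK1 : 2 * (N : ℤ) ≤ K + 1) (hK2 : K ≤ 2 * N) (hpar : (2 : ℤ) ∣ K - t) (k : Fin N) : (X : PowerSeries ℚ) ^ m ∣ ((FM t K N).updateCol k
    (fun i => MM t K (i : ℕ) ((k : ℕ) - t))).det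
      - if (k : ℕ) < t then X * (FM t K N).det else 0 := by
  have hkN := k.2
  have htN := tleN t m N K ht hm hN hK1 hK2 hpar
  split_ifs with h1
  · have key : ∑ j ∈ Finset.range (m + 1), alt j * ((FM t K N).updateCol k
        (fun i => MM t K (i : ℕ) ((k : ℕ) - t + t * j))).det =
        ((FM t K N).updateCol k (fun i => ∑ j ∈ Finset.range (m + 1),
          alt j * MM t K (i : ℕ) ((k : ℕ) - t + t * j))).det := by
      simp only [← Matrix.cramer_apply]
      have : (fun i : Fin N => ∑ j ∈ Finset.range (m + 1),
          alt j * MM t K (i : ℕ) ((k : ℕ) - t + t * j)) = ∑ j ∈ Finset.range (m + 1),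
          alt j • (fun i : Fin N => MM t K (i : ℕ) ((k : ℕ) - t + t * j)) := by
        funext i
        simp [Finset.sum_apply]
      rw [this, map_sum, Finset.sum_apply]
      apply Finset.sum_congr rfl
      intro j _
      rw [map_smul]
      rfl
    have hd : (X : PowerSeries ℚ) ^ m ∣ ((FM t K N).updateCol k
        (fun i => ∑ j ∈ Finset.range (m + 1),
          alt j * MM t K (i : ℕ) ((k : ℕ) - t + t * j))).det := by
      rw [← Matrix.det_transpose, ← Matrix.updateRow_transpose]
      rw [det_updateRow_adj _ (fun (k i : Fin N) => ∑ j ∈ Finset.range (m + 1),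
          alt j * MM t K (i : ℕ) ((k : ℕ) - t + t * j))]
      apply Finset.dvd_sum
      intro i _
      apply Dvd.dvd.mul_right
      simp only [MM, mul_sub, Finset.sum_sub_distrib]
      have hi := i.2
      apply dvd_sub
      · have := hh_column t ht m (((i : ℕ) : ℤ) - k + t) (by omega)
        convert this using 4
        ring
      · have := hh_column t ht m (K - ((i : ℕ) : ℤ) - k + t) (by omega)
        convert this using 4
        ring
    rw [← key] at hd
    obtain ⟨m', rfl⟩ : ∃ m', m = m' + 1 := ⟨m - 1, by omega⟩
    rw [Finset.sum_range_succ', Finset.sum_range_succ', Finset.sum_eq_zero] at hd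
    · have e0 : alt 0 = 1 := by simp [alt]
      have e1 : alt (0 + 1) = - X := by
        simp only [alt]
        rw [PowerSeries.X_eq]
        simp
      have e2 : (FM t K N).updateCol k
        (fun i => MM t K (i : ℕ) (((k : ℕ) : ℤ) - t + t * ((0 + 1 : ℕ) : ℤ))) = FM t K N := by
        have : (((k : ℕ) : ℤ) - t + t * ((0 + 1 : ℕ) : ℤ)) = (k : ℕ) := by push_cast; ring
        rw [this]
        exact Matrix.updateCol_eq_self (FM t K N) k
      have e3 : (((k : ℕ) : ℤ) - t + t * ((0 : ℕ) : ℤ)) = (k : ℕ) - t := by push_cast; ring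
      rw [e0, e1, e2, e3] at hd
      convert hd using 1
      ring
    · intro j hj
      have hj' : j < m' := by simpa using hj
      have hlt : (k : ℕ) + t * (j + 1) < N := by
        have : t * (j + 2) ≤ t * (m' + 1) := Nat.mul_le_mul_left t (by omega)
        nlinarith
      have : (fun i : Fin N => MM t K (i : ℕ) (((k : ℕ) : ℤ) - t + t * ((j + 1 + 1 : ℕ) : ℤ)))
          = (fun i => FM t K N i ⟨k + t * (j + 1), hlt⟩) := by
        funext i
        simp only [FM]
        congr 1
        push_cast
        ring
      rw [this, Matrix.det_updateCol_eq_zero, mul_zero]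
      intro h
      have := congrArg Fin.val h
      simp at this
      omega
  · have : (fun i : Fin N => MM t K (i : ℕ) ((k : ℕ) - t)) = fun i => FM t K N i ⟨k - t, by omega⟩ := by
      funext i
      simp only [FM]
      congr 1
      omega
    rw [this, Matrix.det_updateCol_eq_zero, sub_zero]
    · exact dvd_zero _
    · intro h
      have := congrArg Fin.val h
      simp at this
      omega

theorem FM_ode (t m N : ℕ) (K : ℤ) (ht : 0 < t) (hm : 0 < m) (hN : N = t * m)
    (hK1 : 2 * (N : ℤ) ≤ K + 1) (hK2 : K ≤ 2 * N) (hpar : (2 : ℤ) ∣ K - t) : (X : PowerSeries ℚ) ^ m ∣ PowerSeries.derivative ℚ (FM t K N).det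
    + (FM t K N).det + (t : PowerSeries ℚ) * (X * (FM t K N).det) := by
  have htN := tleN t m N K ht hm hN hK1 hK2 hpar
  have hA := lemA t m N K ht hm hN hK1 hK2 hpar
  have hB : (X : PowerSeries ℚ) ^ m ∣ ∑ i : Fin N, ((FM t K N).updateRow i
    (fun k => MM t K ((i : ℕ) - t) (k : ℕ))).det :=
    Finset.dvd_sum fun i _ => lemB t m N K ht hm hN hK1 hK2 hpar i
  have hC : (X : PowerSeries ℚ) ^ m ∣ ∑ k : Fin N, (((FM t K N).updateCol k
    (fun i => MM t K (i : ℕ) ((k : ℕ) - t))).det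
      - if (k : ℕ) < t then X * (FM t K N).det else 0) :=
    Finset.dvd_sum fun k _ => lemC t m N K ht hm hN hK1 hK2 hpar k
  have hcount : ∑ k : Fin N, (if (k : ℕ) < t then X * (FM t K N).det else 0)
      = (t : PowerSeries ℚ) * (X * (FM t K N).det) := by
    rw [Fin.sum_univ_eq_sum_range (fun k => if k < t then X * (FM t K N).det else 0) N,
      ← Finset.sum_filter]
    have : (Finset.range N).filter (fun k => k < t) = Finset.range t := by
      ext x; simp; omega
    rw [this, Finset.sum_const, Finset.card_range, nsmul_eq_mul]
  rw [Finset.sum_sub_distrib, hcount] at hC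
  rw [← sum_updateRow_eq (FM t K N) (fun i k => MM t K ((i : ℕ) : ℤ) (((k : ℕ) : ℤ) - t))] at hC
  have hsum : (PowerSeries.derivative ℚ (FM t K N).det) + ∑ i : Fin N, ((FM t K N).updateRow i
        (fun k => MM t K ((i : ℕ) : ℤ) (((k : ℕ) : ℤ) - t))).det =
      ∑ i : Fin N, ((FM t K N).updateRow i (fun k => MM t K ((i : ℕ) - t) (k : ℕ))).det
      + ∑ i : Fin N, ((FM t K N).updateRow i (fun k => MM t K ((i : ℕ) + t) (k : ℕ))).det := by
    rw [derivation_det, ← Finset.sum_add_distrib, ← Finset.sum_add_distrib]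
    apply Finset.sum_congr rfl
    intro i _
    rw [← Matrix.det_updateRow_add, ← Matrix.det_updateRow_add]
    congr 2
    funext k
    simp only [Pi.add_apply, FM, MM_derivative t K ht]
    simp only [MM]
    have e1 : ((i : ℕ) : ℤ) - (((k : ℕ) : ℤ) - t) = (i : ℕ) + t - (k : ℕ) := by ring
    have e2 : K - ((i : ℕ) : ℤ) - (((k : ℕ) : ℤ) - t) = K - ((i : ℕ) - t) - (k : ℕ) := by ring
    have e3 : K - ((i : ℕ) : ℤ) - t - (k : ℕ) = K - ((i : ℕ) + t) - (k : ℕ) := by ring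
    rw [e1, e2, e3]
    ring
  rw [hA] at hsum
  have := dvd_sub hB hC
  convert this using 1
  linear_combination hsum

theorem FM_coeff_zero (t m N : ℕ) (K : ℤ) (ht : 0 < t) (hm : 0 < m) (hN : N = t * m)
    (hK1 : 2 * (N : ℤ) ≤ K + 1) (hK2 : K ≤ 2 * N) (hpar : (2 : ℤ) ∣ K - t) : PowerSeries.coeff 0 (FM t K N).det = 1 := by
  rw [PowerSeries.coeff_zero_eq_constantCoeff_apply, RingHom.map_det]
  have : (PowerSeries.constantCoeff (R := ℚ)).mapMatrix (FM t K N) = 1 := by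
    ext i k
    have hi := i.2
    have hk := k.2
    have h0 : ∀ s : ℤ, PowerSeries.constantCoeff (hh t s) = if s = 0 then 1 else 0 := by
      intro s
      by_cases h : ∃ q : ℕ, s = t * q
      · obtain ⟨q, rfl⟩ := h
        rw [hh_mul t ht, ← PowerSeries.coeff_zero_eq_constantCoeff_apply,
          PowerSeries.coeff_monomial]
        rcases Nat.eq_zero_or_pos q with rfl | hq
        · simp
        · have : (t : ℤ) * q ≠ 0 := by positivity
          rw [if_neg (by omega), if_neg this]
      · push Not at h
        rw [hh_not t s h, if_neg, map_zero]
        rintro rfl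
        exact h 0 (by simp)
    simp only [RingHom.mapMatrix_apply, Matrix.map_apply, FM, MM, map_sub, h0, Matrix.one_apply]
    rw [if_neg (c := K - _ - _ = 0) (by omega), sub_zero]
    congr 1
    rw [Fin.ext_iff]
    apply propext
    omega
  rw [this, Matrix.det_one]

theorem FM_coeff (t m N : ℕ) (K : ℤ) (ht : 0 < t) (hm : 0 < m) (hN : N = t * m)
    (hK1 : 2 * (N : ℤ) ≤ K + 1) (hK2 : K ≤ 2 * N) (hpar : (2 : ℤ) ∣ K - t) : PowerSeries.coeff m (FM t K N).det = eCoeff ((t : ℚ) / 2) m := by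
  have h := FM_ode t m N K ht hm hN hK1 hK2 hpar
  have h0 := FM_coeff_zero t m N K ht hm hN hK1 hK2 hpar
  apply rec_unique _ m (fun j => PowerSeries.coeff j (FM t K N).det) h0
  intro j hj
  have := PowerSeries.X_pow_dvd_iff.1 h j hj
  rw [map_add, map_add, PowerSeries.coeff_derivative, ← map_natCast (PowerSeries.C (R := ℚ)),
    PowerSeries.coeff_C_mul] at this
  rw [mul_div_cancel₀ _ (two_ne_zero)]
  cases j with
  | zero => simpa using this
  | succ j =>
    rw [PowerSeries.coeff_succ_X_mul] at this
    simp only [Nat.add_eq_zero_iff, one_ne_zero, and_false, if_false, Nat.add_sub_cancel]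
    linear_combination this

end
end HF

namespace HF

theorem FM_expand (t : ℕ) (K : ℤ) (N : ℕ) : (FM t K N).det =
    ∑ s : Finset (Fin N), (-1) ^ s.card *
      (Matrix.of fun l k : Fin N => hh t ((if l ∈ s then K - (l : ℕ) else (l : ℕ)) - (k : ℕ))).det := by
  have h1 : FM t K N = (fun l k : Fin N => - hh t (K - (l : ℕ) - (k : ℕ))) +
      (fun l k : Fin N => hh t ((l : ℕ) - (k : ℕ))) := by
    funext l k
    simp only [FM, MM, Pi.add_apply]
    ring
  have h2 := (Matrix.detRowAlternating (R := PowerSeries ℚ) (n := Fin N)).toMultilinearMap.map_add_univ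
    (fun l k : Fin N => - hh t (K - (l : ℕ) - (k : ℕ))) (fun l k : Fin N => hh t ((l : ℕ) - (k : ℕ)))
  rw [← h1] at h2
  refine Eq.trans h2 ?_
  refine Finset.sum_congr rfl fun s _ => ?_
  have h3 := Matrix.det_mul_column (fun l : Fin N => if l ∈ s then (-1 : PowerSeries ℚ) else 1)
    (Matrix.of fun l k : Fin N => hh t ((if l ∈ s then K - (l : ℕ) else (l : ℕ)) - (k : ℕ)))
  have h4 : ∏ l : Fin N, (if l ∈ s then (-1 : PowerSeries ℚ) else 1) = (-1) ^ s.card := by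
    rw [Finset.prod_ite_mem]
    simp
  rw [h4] at h3
  rw [← h3]
  show Matrix.det _ = _
  congr 1
  funext l k
  by_cases hl : l ∈ s
  · simp [Finset.piecewise, hl]
  · simp [Finset.piecewise, hl]

theorem hh_desc (t g k : ℕ) (ht : 0 < t) : hh t ((g : ℤ) - (k : ℤ)) * (X : PowerSeries ℚ) ^ (k / t) =
    C (((g / t).factorial : ℚ)⁻¹) *
     (C (if g % t = k % t then ((g / t).descFactorial (k / t) : ℚ) else 0) * X ^ (g / t)) := by
  have hg := Nat.div_add_mod g t
  have hk := Nat.div_add_mod k t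
  by_cases h : g % t = k % t
  · rw [if_pos h]
    have e : (g : ℤ) - k = t * ((g / t : ℕ) - (k / t : ℕ)) := by
      have hg' : (g : ℤ) = t * (g / t : ℕ) + (g % t : ℕ) := by exact_mod_cast hg.symm
      have hk' : (k : ℤ) = t * (k / t : ℕ) + (k % t : ℕ) := by exact_mod_cast hk.symm
      rw [h] at hg'
      linear_combination hg' - hk'
    rw [e]
    generalize g / t = a
    generalize k / t = b
    rcases le_or_gt b a with hab | hab
    · obtain ⟨c, rfl⟩ := Nat.exists_eq_add_of_le hab
      have : (t : ℤ) * (((b + c : ℕ) : ℤ) - (b : ℕ)) = t * (c : ℕ) := by push_cast; ring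
      rw [this, hh_mul t ht]
      have h5 : (c.factorial : ℚ) * ((b + c).descFactorial b) = (b + c).factorial := by
        have := Nat.factorial_mul_descFactorial (n := b + c) (k := b) (by omega)
        rw [Nat.add_sub_cancel_left] at this
        exact_mod_cast this
      have h6 : ((b + c).factorial : ℚ)⁻¹ * ((b + c).descFactorial b) = (c.factorial : ℚ)⁻¹ := by
        rw [← h5]
        have : (c.factorial : ℚ) ≠ 0 := by positivity
        have : ((b + c).descFactorial b : ℚ) ≠ 0 := by
          intro h0
          rw [h0, mul_zero] at h5
          exact absurd h5.symm (by positivity)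
        field_simp
      have h7 : (monomial c ((c.factorial : ℚ)⁻¹) : PowerSeries ℚ) = C ((c.factorial : ℚ)⁻¹) * X ^ c := by
        ext i
        rw [coeff_C_mul, coeff_X_pow, coeff_monomial, mul_ite, mul_one, mul_zero]
      rw [← mul_assoc, ← map_mul, h6, h7, add_comm b c, pow_add, mul_assoc]
    · rw [hh_neg, Nat.descFactorial_of_lt hab]
      · simp
      · have : (0 : ℤ) < t := by exact_mod_cast ht
        have : ((a : ℤ) - b) < 0 := by omega
        nlinarith
  · rw [if_neg h, hh_not]
    · simp
    · intro q hq
      apply h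
      have : g = k + t * q := by zify; linarith
      rw [this, Nat.add_mul_mod_self_left]

/-- desc factorial matrix -/
def AA (t N : ℕ) (G : Fin N → ℕ) : Matrix (Fin N) (Fin N) ℚ :=
  Matrix.of fun l k => if G l % t = (k : ℕ) % t then ((G l / t).descFactorial ((k : ℕ) / t) : ℚ) else 0

theorem det_hh (t N : ℕ) (ht : 0 < t) (G : Fin N → ℕ) :
    (Matrix.of fun l k : Fin N => hh t ((G l : ℤ) - ((k : ℕ) : ℤ))).det * X ^ (∑ k : Fin N, (k : ℕ) / t) =
      C ((∏ l, ((G l / t).factorial : ℚ)⁻¹) * (AA t N G).det) * X ^ (∑ l, G l / t) := by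
  have h1 := Matrix.det_mul_row (fun k : Fin N => (X : PowerSeries ℚ) ^ ((k : ℕ) / t))
    (Matrix.of fun l k : Fin N => hh t ((G l : ℤ) - ((k : ℕ) : ℤ)))
  have h2 := Matrix.det_mul_column (fun l : Fin N => C (((G l / t).factorial : ℚ)⁻¹) * (X : PowerSeries ℚ) ^ (G l / t))
    ((C : ℚ →+* PowerSeries ℚ).mapMatrix (AA t N G))
  rw [Finset.prod_pow_eq_pow_sum] at h1
  rw [Finset.prod_mul_distrib, Finset.prod_pow_eq_pow_sum, ← map_prod, ← RingHom.map_det] at h2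
  rw [mul_comm, ← h1, map_mul, mul_assoc, mul_comm (C _) (X ^ _), ← mul_assoc, ← h2]
  congr 1
  funext l k
  simp only [Matrix.of_apply, RingHom.mapMatrix_apply, Matrix.map_apply, AA]
  rw [mul_comm, hh_desc t _ _ ht]
  ring

theorem coeff_det_hh (t N n : ℕ) (ht : 0 < t) (G : Fin N → ℕ) :
    coeff n (Matrix.of fun l k : Fin N => hh t ((G l : ℤ) - ((k : ℕ) : ℤ))).det =
    if ∑ l, G l / t = n + ∑ k : Fin N, (k : ℕ) / t then
      (∏ l, ((G l / t).factorial : ℚ)⁻¹) * (AA t N G).det else 0 := by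
  have h := congrArg (coeff (n + ∑ k : Fin N, (k : ℕ) / t)) (det_hh t N ht G)
  rw [coeff_mul_X_pow, coeff_C_mul, coeff_X_pow] at h
  rw [h]
  by_cases h1 : ∑ l, G l / t = n + ∑ k : Fin N, (k : ℕ) / t
  · rw [if_pos h1, if_pos h1.symm, mul_one]
  · rw [if_neg h1, if_neg (fun h => h1 h.symm), mul_zero]

theorem det_AA (t m N : ℕ) (ht : 0 < t) (hN : N = m * t) (G : Fin N → ℕ)
    (hG : ∀ k, G k % t = (k : ℕ) % t) :
    (AA t N G).det = ∏ k : Fin N, ∏ k' : Fin N,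
      if k < k' ∧ (k : ℕ) % t = (k' : ℕ) % t then (((G k' / t : ℕ) : ℚ) - ((G k / t : ℕ) : ℚ)) else 1 := by
  subst hN
  have hv : ∀ (q : Fin m) (r : Fin t), ((finProdFinEquiv (q, r) : Fin (m * t)) : ℕ) = r + t * q := fun q r => rfl
  have hmod : ∀ (q : Fin m) (r : Fin t), ((finProdFinEquiv (q, r) : Fin (m * t)) : ℕ) % t = r := by
    intro q r
    rw [hv, Nat.add_mul_mod_self_left, Nat.mod_eq_of_lt r.2]
  have hdiv : ∀ (q : Fin m) (r : Fin t), ((finProdFinEquiv (q, r) : Fin (m * t)) : ℕ) / t = q := by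
    intro q r
    rw [hv, Nat.add_mul_div_left _ _ ht, Nat.div_eq_of_lt r.2, zero_add]
  rw [← Matrix.det_submatrix_equiv_self finProdFinEquiv]
  have hb : (AA t (m * t) G).submatrix finProdFinEquiv finProdFinEquiv =
      Matrix.blockDiagonal (fun r : Fin t => Matrix.of fun q q' : Fin m =>
        (((descPochhammer ℚ q').eval ((G (finProdFinEquiv (q, r)) / t : ℕ) : ℚ)))) := by
    ext ⟨q, r⟩ ⟨q', r'⟩
    rw [Matrix.blockDiagonal_apply]
    simp only [Matrix.submatrix_apply, AA, Matrix.of_apply, hG, hmod, hdiv,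
      descPochhammer_eval_eq_descFactorial, Fin.val_inj]
  rw [hb, Matrix.det_blockDiagonal]
  have hd : ∀ r : Fin t, (Matrix.of fun q q' : Fin m =>
        (((descPochhammer ℚ q').eval ((G (finProdFinEquiv (q, r)) / t : ℕ) : ℚ)))).det =
        ∏ q : Fin m, ∏ q' : Fin m, if q < q' then (((G (finProdFinEquiv (q', r)) / t : ℕ) : ℚ) - ((G (finProdFinEquiv (q, r)) / t : ℕ) : ℚ)) else 1 := by
    intro r
    have := Matrix.det_eval_matrixOfPolynomials_eq_det_vandermonde
      (fun q => ((G (finProdFinEquiv (q, r)) / t : ℕ) : ℚ)) (fun q' : Fin m => descPochhammer ℚ q')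
      (fun i => descPochhammer_natDegree _ _) (fun i => monic_descPochhammer _ _)
    rw [← this, Matrix.det_vandermonde]
    refine Finset.prod_congr rfl fun q _ => ?_
    rw [← Finset.prod_filter]
    refine Finset.prod_congr ?_ fun _ _ => rfl
    ext; simp
  rw [Finset.prod_congr rfl fun r _ => hd r]
  rw [← Fintype.prod_equiv finProdFinEquiv _ _ (fun x => rfl), Fintype.prod_prod_type, Finset.prod_comm]
  refine Finset.prod_congr rfl fun q _ => Finset.prod_congr rfl fun r _ => ?_
  rw [← Fintype.prod_equiv finProdFinEquiv _ _ (fun x => rfl), Fintype.prod_prod_type]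
  refine Finset.prod_congr rfl fun q' _ => ?_
  rw [Finset.prod_eq_single r]
  · simp only [hmod, Fin.lt_def, hv]
    congr 1
    simp [ht]
  · intro r' _ hr
    rw [if_neg]
    rw [hmod, hmod]
    rintro ⟨_, h⟩
    exact hr (Fin.ext h.symm)
  · simp

end HF

namespace HF

/-- reflected beads -/
def gg (K : ℕ) (P : Finset ℕ) (l : ℕ) : ℕ := if l ∈ P then K - l else l

/-- balanced sets -/
def Bal (t K : ℕ) (P : Finset ℕ) : Prop :=
  ∀ r, (P.filter fun l => l % t = r).card = (P.filter fun l => (K - l) % t = r).card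

theorem mod_flip (t K a b : ℕ) (ha : a ≤ K) (hb : b ≤ K) : (K - a) % t = b % t ↔ (K - b) % t = a % t := by
  have h1 : (K - a) % t = b % t ↔ K % t = (a + b) % t := by
    constructor
    · intro h
      have : (K - a + a) % t = (b + a) % t := Nat.ModEq.add_right a h
      rwa [Nat.sub_add_cancel ha, add_comm b a] at this
    · intro h
      have : (K - a + a) % t = (b + a) % t := by rwa [Nat.sub_add_cancel ha, add_comm b a]
      exact Nat.ModEq.add_right_cancel' a this
  have h2 : (K - b) % t = a % t ↔ K % t = (a + b) % t := by
    constructor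
    · intro h
      have : (K - b + b) % t = (a + b) % t := Nat.ModEq.add_right b h
      rwa [Nat.sub_add_cancel hb] at this
    · intro h
      have : (K - b + b) % t = (a + b) % t := by rwa [Nat.sub_add_cancel hb]
      exact Nat.ModEq.add_right_cancel' b this
  rw [h1, h2]

theorem mod_refl (t K a b : ℕ) (ha : a ≤ K) (hb : b ≤ K) : (K - a) % t = (K - b) % t ↔ a % t = b % t := by
  rw [mod_flip t K a (K - b) ha (by omega), Nat.sub_sub_self hb, eq_comm]

/-- the class predicate -/
def pr (t : ℕ) (P : Finset ℕ) (r x : ℕ) : Prop := x ∈ P ∧ x % t = r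

instance (t : ℕ) (P : Finset ℕ) (r : ℕ) : DecidablePred (pr t P r) := fun _ => by unfold pr; infer_instance

theorem pr_fin (t : ℕ) (P : Finset ℕ) (r : ℕ) : (Set.ofPred (pr t P r)).Finite :=
  P.finite_toSet.subset fun _ hx => hx.1

theorem pr_card (t : ℕ) (P : Finset ℕ) (r : ℕ) :
    (pr_fin t P r).toFinset.card = (P.filter fun l => l % t = r).card := by
  congr 1
  ext x
  rw [Set.Finite.mem_toFinset, Finset.mem_filter]
  exact Iff.rfl

/-- the involution -/
def sig (t K : ℕ) (P : Finset ℕ) (l : ℕ) : ℕ :=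
  if l ∈ P then Nat.nth (pr t P ((K - l) % t)) (Nat.count (pr t P (l % t)) l) else l

theorem bal_card (t K : ℕ) (P : Finset ℕ) (hP : ∀ l ∈ P, l ≤ K) (hb : Bal t K P) (l : ℕ) (hl : l ∈ P) :
    (P.filter fun x => x % t = (K - l) % t).card = (P.filter fun x => x % t = l % t).card := by
  rw [hb]
  congr 1
  ext x
  simp only [Finset.mem_filter]
  refine and_congr_right fun hx => ?_
  rw [mod_refl t K x l (hP x hx) (hP l hl)]

theorem sig_lt (t K : ℕ) (P : Finset ℕ) (hP : ∀ l ∈ P, l ≤ K) (hb : Bal t K P) (l : ℕ) (hl : l ∈ P) :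
    Nat.count (pr t P (l % t)) l < (pr_fin t P ((K - l) % t)).toFinset.card := by
  rw [pr_card, bal_card t K P hP hb l hl, ← pr_card]
  exact Nat.count_lt_card _ ⟨hl, rfl⟩

theorem sig_mem (t K : ℕ) (P : Finset ℕ) (hP : ∀ l ∈ P, l ≤ K) (hb : Bal t K P) (l : ℕ) (hl : l ∈ P) :
    sig t K P l ∈ P ∧ sig t K P l % t = (K - l) % t := by
  rw [sig, if_pos hl]
  exact Nat.nth_mem_of_lt_card _ (sig_lt t K P hP hb l hl)

theorem sig_sig (t K : ℕ) (P : Finset ℕ) (hP : ∀ l ∈ P, l ≤ K) (hb : Bal t K P) (l : ℕ) :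
    sig t K P (sig t K P l) = l := by
  by_cases hl : l ∈ P
  · obtain ⟨h1, h2⟩ := sig_mem t K P hP hb l hl
    have h3 : (K - sig t K P l) % t = l % t := by
      rw [mod_flip t K _ _ (hP _ h1) (hP _ hl), h2]
    rw [sig, if_pos h1, h3, h2]
    have h4 : Nat.count (pr t P ((K - l) % t)) (sig t K P l) = Nat.count (pr t P (l % t)) l := by
      rw [sig, if_pos hl]
      exact Nat.count_nth_of_lt_card_finite _ (sig_lt t K P hP hb l hl)
    rw [h4]
    exact Nat.nth_count ⟨hl, rfl⟩
  · have : sig t K P l = l := by rw [sig, if_neg hl]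
    rw [this, this]

theorem sig_mono (t K : ℕ) (P : Finset ℕ) (hP : ∀ l ∈ P, l ≤ K) (hb : Bal t K P) (l l' : ℕ) (hl : l ∈ P)
    (hl' : l' ∈ P) (h : l < l') (hm : l % t = l' % t) : sig t K P l < sig t K P l' := by
  rw [sig, if_pos hl, sig, if_pos hl', (mod_refl t K l l' (hP _ hl) (hP _ hl')).2 hm, ← hm]
  have := sig_lt t K P hP hb l' hl'
  rw [← hm] at this
  exact Nat.nth_lt_nth_of_lt_card _ (Nat.count_strict_mono ⟨hl, rfl⟩ h) this

theorem sig_fix (t K : ℕ) (P : Finset ℕ) (hP : ∀ l ∈ P, l ≤ K) (hb : Bal t K P) (l : ℕ) (hl : l ∈ P) :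
    sig t K P l = l ↔ l % t = (K - l) % t := by
  constructor
  · intro h
    have := (sig_mem t K P hP hb l hl).2
    rwa [h] at this
  · intro h
    rw [sig, if_pos hl, ← h]
    exact Nat.nth_count ⟨hl, rfl⟩

theorem gg_sig_mod (t K : ℕ) (P : Finset ℕ) (hP : ∀ l ∈ P, l ≤ K) (hb : Bal t K P) (l : ℕ) :
    gg K P (sig t K P l) % t = l % t := by
  by_cases hl : l ∈ P
  · obtain ⟨h1, h2⟩ := sig_mem t K P hP hb l hl
    rw [gg, if_pos h1, mod_flip t K _ _ (hP _ h1) (hP _ hl), h2]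
  · have : sig t K P l = l := by rw [sig, if_neg hl]
    rw [this, gg, if_neg hl]

theorem sig_ltN (t K N : ℕ) (P : Finset ℕ) (hPN : ∀ l ∈ P, l < N) (hP : ∀ l ∈ P, l ≤ K) (hb : Bal t K P)
    (l : ℕ) (hl : l < N) : sig t K P l < N := by
  by_cases h : l ∈ P
  · exact hPN _ (sig_mem t K P hP hb l h).1
  · rwa [sig, if_neg h]

theorem orient {N : ℕ} (G : Fin N → ℕ) (hG : Function.Injective G) (f : Fin N → Fin N → ℚ)
    (hf : ∀ i j, f i j = f j i) :
    ∏ i, ∏ j, (if i < j then f i j else 1) = ∏ i, ∏ j, (if G i < G j then f i j else 1) := by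
  have h1 : ∏ i, ∏ j, (if i < j then f i j else 1) =
      (∏ i, ∏ j, (if i < j ∧ G i < G j then f i j else 1)) *
       ∏ i, ∏ j, (if i < j ∧ G j < G i then f i j else 1) := by
    simp only [← Finset.prod_mul_distrib]
    refine Finset.prod_congr rfl fun i _ => Finset.prod_congr rfl fun j _ => ?_
    by_cases h : i < j
    · have : G i ≠ G j := fun h' => h.ne (hG h')
      rcases lt_or_gt_of_ne this with h2 | h2
      · simp [h, h2, h2.not_gt]
      · simp [h, h2, h2.not_gt]
    · simp [h]
  have h2 : ∏ i, ∏ j, (if G i < G j then f i j else 1) =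
      (∏ i, ∏ j, (if i < j ∧ G i < G j then f i j else 1)) *
       ∏ i, ∏ j, (if j < i ∧ G i < G j then f i j else 1) := by
    simp only [← Finset.prod_mul_distrib]
    refine Finset.prod_congr rfl fun i _ => Finset.prod_congr rfl fun j _ => ?_
    by_cases h : G i < G j
    · have : i ≠ j := fun h' => h.ne (by rw [h'])
      rcases lt_or_gt_of_ne this with h2 | h2
      · simp [h, h2, h2.not_gt]
      · simp [h, h2, h2.not_gt]
    · simp [h]
  rw [h1, h2]
  congr 1
  rw [Finset.prod_comm]
  simp only [hf]

theorem gg_inj (K N : ℕ) (hK : 2 * N ≤ K + 1) (P : Finset ℕ) (a b : ℕ) (ha : a < N) (hb : b < N)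
    (h : gg K P a = gg K P b) : a = b := by
  unfold gg at h
  split_ifs at h <;> omega

end HF

namespace HF

/-- the bead set -/
def LL (N K : ℕ) (P : Finset ℕ) : Finset ℕ := (Finset.range N).image (gg K P)

theorem det_AA_gg (t m N K : ℕ) (ht : 0 < t) (hN : N = m * t) (hK : 2 * N ≤ K + 1) (P : Finset ℕ)
    (hPN : ∀ l ∈ P, l < N) (hb : Bal t K P) :
    (AA t N (fun l => gg K P l)).det =
      (-1) ^ ((P.filter fun l => l % t ≠ (K - l) % t).card / 2 +
        ((Finset.range N ×ˢ Finset.range N).filter fun k => k.1 < k.2 ∧ k.1 % t = k.2 % t ∧ k.1 ∈ P).card) *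
      ∏ x ∈ LL N K P, ∏ y ∈ LL N K P, (if y < x ∧ y % t = x % t then ((x / t : ℕ) : ℚ) - ((y / t : ℕ) : ℚ) else 1) := by
  have hP : ∀ l ∈ P, l ≤ K := fun l hl => by have := hPN l hl; omega
  let σ : Equiv.Perm (Fin N) := Function.Involutive.toPerm
    (fun l => ⟨sig t K P l, sig_ltN t K N P hPN hP hb l l.2⟩)
    (fun l => Fin.ext (sig_sig t K P hP hb l))
  have hσ : ∀ l : Fin N, ((σ l : Fin N) : ℕ) = sig t K P l := fun l => rfl
  have hσ2 : σ ^ 2 = 1 := by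
    ext l
    rw [pow_two, Equiv.Perm.mul_apply, hσ, hσ, sig_sig t K P hP hb]
    rfl
  have hsign : Equiv.Perm.sign σ = (-1) ^ ((P.filter fun l => l % t ≠ (K - l) % t).card / 2) := by
    rw [Equiv.Perm.sign_of_pow_two_eq_one hσ2]
    congr 2
    have h1 : Fintype.card ↑(Function.fixedPoints ⇑σ) = (Finset.univ.filter fun l => σ l = l).card := by
      rw [Fintype.card_subtype]
      rfl
    have h2 : (Finset.univ.filter fun l => σ l = l).card + (Finset.univ.filter fun l => ¬ σ l = l).card =
        Fintype.card (Fin N) := by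
      rw [Finset.card_filter_add_card_filter_not, Finset.card_univ]
    have h3 : (P.filter fun l => l % t ≠ (K - l) % t) =
        (Finset.univ.filter fun l => ¬ σ l = l).map Fin.valEmbedding := by
      ext x
      simp only [Finset.mem_filter, Finset.mem_map, Finset.mem_univ, true_and, Fin.valEmbedding_apply]
      constructor
      · rintro ⟨hx, hne⟩
        refine ⟨⟨x, hPN x hx⟩, fun h => hne ?_, rfl⟩
        rw [← sig_fix t K P hP hb x hx]
        exact congrArg Fin.val h
      · rintro ⟨l, hl, rfl⟩
        have hlP : (l : ℕ) ∈ P := by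
          by_contra hlP
          apply hl
          apply Fin.ext
          rw [hσ, sig, if_neg hlP]
        refine ⟨hlP, fun h => hl ?_⟩
        rw [← sig_fix t K P hP hb l hlP] at h
        exact Fin.ext h
    rw [h3, Finset.card_map, h1]
    omega
  let G : Fin N → ℕ := fun l => gg K P (σ l)
  have hGmod : ∀ l : Fin N, G l % t = (l : ℕ) % t := fun l => gg_sig_mod t K P hP hb l
  have hGinj : Function.Injective G := fun a b h =>
    σ.injective (Fin.ext (gg_inj K N hK P _ _ (σ a).2 (σ b).2 h))
  have hdet : (AA t N (fun l => gg K P l)).det = (Equiv.Perm.sign σ : ℤ) * (AA t N G).det := by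
    have h := Matrix.det_permute σ (AA t N (fun l => gg K P l))
    have h2 : (AA t N (fun l => gg K P l)).submatrix σ id = AA t N G := rfl
    rw [h2] at h
    rw [h, ← mul_assoc, ← Int.cast_mul, ← Units.val_mul, Int.units_mul_self]
    simp
  rw [hdet, hsign, det_AA t m N ht hN G hGmod, pow_add, mul_assoc]
  have hs : ((((-1 : ℤˣ) ^ ((P.filter fun l => l % t ≠ (K - l) % t).card / 2) : ℤˣ) : ℤ) : ℚ) =
     (-1) ^ ((P.filter fun l => l % t ≠ (K - l) % t).card / 2) := by
    push_cast
    rfl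
  rw [hs]
  congr 1
  have hord : ∀ k k' : Fin N, k < k' → (k : ℕ) % t = (k' : ℕ) % t →
      (G k' < G k ∧ (k : ℕ) ∈ P) ∨ (G k < G k' ∧ (k : ℕ) ∉ P) := by
    intro k k' hkk hmod
    have hkk' : (k : ℕ) < k' := hkk
    have hk2 := k.2
    have hk2' := k'.2
    by_cases hk : (k : ℕ) ∈ P
    · left
      refine ⟨?_, hk⟩
      obtain ⟨h1, _⟩ := sig_mem t K P hP hb k hk
      have h1' := hPN _ h1
      have e1 : G k = K - sig t K P k := by
        show gg K P (sig t K P k) = _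
        rw [gg, if_pos h1]
      by_cases hk' : (k' : ℕ) ∈ P
      · obtain ⟨h2, _⟩ := sig_mem t K P hP hb k' hk'
        have h2' := hPN _ h2
        have e2 : G k' = K - sig t K P k' := by
          show gg K P (sig t K P k') = _
          rw [gg, if_pos h2]
        have := sig_mono t K P hP hb k k' hk hk' hkk hmod
        omega
      · have e2 : G k' = k' := by
          show gg K P (sig t K P k') = _
          have : sig t K P k' = k' := by rw [sig, if_neg hk']
          rw [this, gg, if_neg hk']
        omega
    · right
      refine ⟨?_, hk⟩
      have e1 : G k = k := by
        show gg K P (sig t K P k) = _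
        have : sig t K P k = k := by rw [sig, if_neg hk]
        rw [this, gg, if_neg hk]
      by_cases hk' : (k' : ℕ) ∈ P
      · obtain ⟨h2, _⟩ := sig_mem t K P hP hb k' hk'
        have h2' := hPN _ h2
        have e2 : G k' = K - sig t K P k' := by
          show gg K P (sig t K P k') = _
          rw [gg, if_pos h2]
        omega
      · have e2 : G k' = k' := by
          show gg K P (sig t K P k') = _
          have : sig t K P k' = k' := by rw [sig, if_neg hk']
          rw [this, gg, if_neg hk']
        omega
  have hsplit : ∏ k : Fin N, ∏ k' : Fin N,
      (if k < k' ∧ (k : ℕ) % t = (k' : ℕ) % t then (((G k' / t : ℕ) : ℚ) - ((G k / t : ℕ) : ℚ)) else 1) =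
      (∏ k : Fin N, ∏ k' : Fin N,
        (if (k : ℕ) < k' ∧ (k : ℕ) % t = (k' : ℕ) % t ∧ (k : ℕ) ∈ P then (-1 : ℚ) else 1)) *
      ∏ k : Fin N, ∏ k' : Fin N, (if k < k' then (if G k % t = G k' % t then
          |((G k' / t : ℕ) : ℚ) - ((G k / t : ℕ) : ℚ)| else 1) else 1) := by
    simp only [← Finset.prod_mul_distrib]
    refine Finset.prod_congr rfl fun k _ => Finset.prod_congr rfl fun k' _ => ?_
    rw [hGmod, hGmod]
    by_cases h1 : k < k'
    · have h1' : (k : ℕ) < k' := h1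
      by_cases h2 : (k : ℕ) % t = (k' : ℕ) % t
      · rcases hord k k' h1 h2 with ⟨h3, h4⟩ | ⟨h3, h4⟩
        · have : ((G k' / t : ℕ) : ℚ) ≤ ((G k / t : ℕ) : ℚ) := by
            exact_mod_cast Nat.div_le_div_right h3.le
          rw [if_pos ⟨h1, h2⟩, if_pos ⟨h1', h2, h4⟩, if_pos h1, if_pos h2, abs_of_nonpos (by linarith)]
          ring
        · have : ((G k / t : ℕ) : ℚ) ≤ ((G k' / t : ℕ) : ℚ) := by
            exact_mod_cast Nat.div_le_div_right h3.le
          rw [if_pos ⟨h1, h2⟩, if_neg (fun h => h4 h.2.2), if_pos h1, if_pos h2, abs_of_nonneg (by linarith)]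
          ring
      · simp [h2]
    · have h1' : ¬ (k : ℕ) < k' := h1
      simp [h1, h1']
  rw [hsplit, orient G hGinj]
  · congr 1
    · rw [← Finset.prod_const, Finset.prod_filter, Finset.prod_product, ← Fin.prod_univ_eq_prod_range
        (fun k => ∏ k' ∈ Finset.range N, (if k < k' ∧ k % t = k' % t ∧ k ∈ P then (-1 : ℚ) else 1))]
      refine Finset.prod_congr rfl fun k _ => ?_
      rw [← Fin.prod_univ_eq_prod_range
        (fun k' => (if (k : ℕ) < k' ∧ (k : ℕ) % t = k' % t ∧ (k : ℕ) ∈ P then (-1 : ℚ) else 1))]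
    · have hL : LL N K P = Finset.univ.image G := by
        ext x
        simp only [LL, Finset.mem_image, Finset.mem_range, Finset.mem_univ, true_and]
        constructor
        · rintro ⟨l, hl, rfl⟩
          refine ⟨σ ⟨l, hl⟩, ?_⟩
          show gg K P (sig t K P (sig t K P l)) = _
          rw [sig_sig t K P hP hb]
        · rintro ⟨l, rfl⟩
          exact ⟨σ l, (σ l).2, rfl⟩
      rw [hL, Finset.prod_image (fun a _ b _ h => hGinj h)]
      simp_rw [Finset.prod_image (fun a _ b _ h => hGinj h : Set.InjOn G _)]
      rw [Finset.prod_comm]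
      refine Finset.prod_congr rfl fun k' _ => Finset.prod_congr rfl fun k _ => ?_
      by_cases h1 : G k < G k'
      · have : ((G k / t : ℕ) : ℚ) ≤ ((G k' / t : ℕ) : ℚ) := by
            exact_mod_cast Nat.div_le_div_right h1.le
        by_cases h2 : G k % t = G k' % t
        · rw [if_pos h1, if_pos h2, if_pos ⟨h1, h2⟩, abs_of_nonneg (by linarith)]
        · simp [h2]
      · simp [h1]
  · intro i j
    by_cases h : G i % t = G j % t
    · rw [if_pos h, if_pos h.symm, abs_sub_comm]
    · rw [if_neg h, if_neg (fun h' => h h'.symm)]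

end HF

namespace HF

/-- count of a residue class -/
def cnt (t : ℕ) (L : Finset ℕ) (r : ℕ) : ℕ := (L.filter fun l => l % t = r).card

/-- hook pairs -/
def HH (t : ℕ) (L : Finset ℕ) : Finset (ℕ × ℕ) :=
  (L ×ˢ Finset.range (L.sup id)).filter fun p => p.2 ∉ L ∧ p.2 < p.1 ∧ p.2 % t = p.1 % t

theorem mem_HH (t : ℕ) (L : Finset ℕ) (p : ℕ × ℕ) :
    p ∈ HH t L ↔ p.1 ∈ L ∧ p.2 ∉ L ∧ p.2 < p.1 ∧ p.2 % t = p.1 % t := by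
  rw [HH, Finset.mem_filter, Finset.mem_product, Finset.mem_range]
  constructor
  · rintro ⟨⟨h1, _⟩, h2⟩
    exact ⟨h1, h2⟩
  · rintro ⟨h1, h2⟩
    exact ⟨⟨h1, lt_of_lt_of_le h2.2.1 (Finset.le_sup (f := id) h1)⟩, h2⟩

/-- the smaller elements of the class -/
def cls (t x : ℕ) : Finset ℕ := (Finset.range (x / t)).image fun k => x % t + t * k

theorem mem_cls (t x : ℕ) (ht : 0 < t) (y : ℕ) : y ∈ cls t x ↔ y < x ∧ y % t = x % t := by
  rw [cls, Finset.mem_image]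
  have hx := Nat.div_add_mod x t
  constructor
  · rintro ⟨k, hk, rfl⟩
    rw [Finset.mem_range] at hk
    have : t * k < t * (x / t) := Nat.mul_lt_mul_of_pos_left hk ht
    refine ⟨by omega, ?_⟩
    rw [Nat.add_mul_mod_self_left, Nat.mod_mod]
  · rintro ⟨h1, h2⟩
    have hy := Nat.div_add_mod y t
    refine ⟨y / t, ?_, by omega⟩
    rw [Finset.mem_range]
    by_contra h
    have : t * (x / t) ≤ t * (y / t) := Nat.mul_le_mul_left _ (not_lt.1 h)
    omega

theorem cls_inj (t x : ℕ) (ht : 0 < t) (s : Set ℕ) : Set.InjOn (fun k => x % t + t * k) s := by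
  intro a _ b _ h
  have : t * a = t * b := by simpa using h
  exact Nat.eq_of_mul_eq_mul_left ht this

theorem cls_card (t x : ℕ) (ht : 0 < t) : (cls t x).card = x / t := by
  rw [cls, Finset.card_image_of_injOn (cls_inj t x ht _), Finset.card_range]

theorem cls_prod (t x : ℕ) (ht : 0 < t) :
    ∏ y ∈ cls t x, (((x / t : ℕ) : ℚ) - ((y / t : ℕ) : ℚ)) = (x / t).factorial := by
  rw [cls, Finset.prod_image (cls_inj t x ht _), ← Nat.descFactorial_self, Nat.descFactorial_eq_prod_range]
  push_cast
  refine Finset.prod_congr rfl fun k hk => ?_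
  rw [Finset.mem_range] at hk
  rw [Nat.cast_sub hk.le, Nat.add_mul_div_left _ _ ht, Nat.div_eq_of_lt (Nat.mod_lt _ ht), zero_add]

theorem HH_prod (t : ℕ) (ht : 0 < t) (L : Finset ℕ) :
    (∏ x ∈ L, ((x / t).factorial : ℚ)⁻¹) *
      ∏ x ∈ L, ∏ y ∈ L, (if y < x ∧ y % t = x % t then ((x / t : ℕ) : ℚ) - ((y / t : ℕ) : ℚ) else 1) =
    ∏ p ∈ HH t L, (t : ℚ) / ((p.1 : ℚ) - (p.2 : ℚ)) := by
  rw [Finset.prod_finset_product (HH t L) L (fun x => (cls t x).filter fun y => y ∉ L)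
    (fun p => by rw [mem_HH, Finset.mem_filter, mem_cls _ _ ht]; tauto), ← Finset.prod_mul_distrib]
  refine Finset.prod_congr rfl fun x _ => ?_
  have h1 : ∏ y ∈ L, (if y < x ∧ y % t = x % t then ((x / t : ℕ) : ℚ) - ((y / t : ℕ) : ℚ) else 1) =
      ∏ y ∈ (cls t x).filter (fun y => y ∈ L), (((x / t : ℕ) : ℚ) - ((y / t : ℕ) : ℚ)) := by
    rw [← Finset.prod_filter]
    refine Finset.prod_congr ?_ fun _ _ => rfl
    ext y
    rw [Finset.mem_filter, Finset.mem_filter, mem_cls _ _ ht]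
    tauto
  have h2 := cls_prod t x ht
  rw [← Finset.prod_filter_mul_prod_filter_not _ (fun y => y ∈ L)] at h2
  have h3 : ∏ y ∈ (cls t x).filter (fun y => y ∉ L), (t : ℚ) / ((x : ℚ) - (y : ℚ)) =
      (∏ y ∈ (cls t x).filter (fun y => y ∉ L), (((x / t : ℕ) : ℚ) - ((y / t : ℕ) : ℚ)))⁻¹ := by
    rw [← Finset.prod_inv_distrib]
    refine Finset.prod_congr rfl fun y hy => ?_
    rw [Finset.mem_filter, mem_cls _ _ ht] at hy
    have hx' : (x : ℚ) = t * (x / t : ℕ) + (x % t : ℕ) := by exact_mod_cast (Nat.div_add_mod x t).symm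
    have hy' : (y : ℚ) = t * (y / t : ℕ) + (y % t : ℕ) := by exact_mod_cast (Nat.div_add_mod y t).symm
    have e : (x : ℚ) - y = t * (((x / t : ℕ) : ℚ) - ((y / t : ℕ) : ℚ)) := by
      rw [hy.1.2] at hy'
      linear_combination hx' - hy'
    rw [e]
    have : (t : ℚ) ≠ 0 := by positivity
    rw [div_mul_eq_div_div, div_self this, one_div]
  rw [h1, h3, ← h2]
  have hne : ((x / t).factorial : ℚ) ≠ 0 := by positivity
  rw [← h2] at hne
  have ha := left_ne_zero_of_mul hne
  have hb := right_ne_zero_of_mul hne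
  field_simp

theorem sum_mod_fiber (t : ℕ) (ht : 0 < t) (L : Finset ℕ) (f : ℕ → ℤ) :
    ∑ x ∈ L, f (x % t) = ∑ r ∈ Finset.range t, (cnt t L r : ℤ) * f r := by
  rw [← Finset.sum_fiberwise_of_maps_to (t := Finset.range t) (g := fun x => x % t)
    (fun x _ => Finset.mem_range.2 (Nat.mod_lt _ ht))]
  refine Finset.sum_congr rfl fun r _ => ?_
  rw [Finset.sum_congr rfl (g := fun _ => f r)]
  · rw [Finset.sum_const, cnt, nsmul_eq_mul]
  · intro x hx
    rw [(Finset.mem_filter.1 hx).2]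

theorem HH_energy (t : ℕ) (ht : 0 < t) (L : Finset ℕ) :
    2 * (t : ℤ) * (HH t L).card = 2 * ∑ x ∈ L, (x : ℤ) -
      ∑ r ∈ Finset.range t, ((cnt t L r : ℤ) * (2 * r) + t * ((cnt t L r : ℤ) ^ 2 - cnt t L r)) := by
  have h1 : (HH t L).card = ∑ x ∈ L, ((cls t x).filter fun y => y ∉ L).card := by
    have := Finset.sum_finset_product (HH t L) L (fun x => (cls t x).filter fun y => y ∉ L)
      (fun p => by rw [mem_HH, Finset.mem_filter, mem_cls _ _ ht]; tauto) (f := fun _ => 1)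
    simpa using this
  have h2 : ∀ x ∈ L, ((x : ℤ) = t * (((cls t x).filter fun y => y ∉ L).card +
      (L.filter fun y => y < x ∧ y % t = x % t).card) + (x % t : ℕ)) := by
    intro x _
    have h3 := Finset.card_filter_add_card_filter_not (s := cls t x) (fun y => y ∈ L)
    have h4 : (cls t x).filter (fun y => y ∈ L) = L.filter fun y => y < x ∧ y % t = x % t := by
      ext y
      rw [Finset.mem_filter, Finset.mem_filter, mem_cls _ _ ht]
      tauto
    rw [h4, cls_card t x ht] at h3
    have h5 := Nat.div_add_mod x t
    rw [← h3] at h5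
    have h6 := h5.symm
    zify at h6 ⊢
    linear_combination h6
  have h3 : 2 * ∑ x ∈ L, ((L.filter fun y => y < x ∧ y % t = x % t).card : ℤ) + L.card =
      ∑ x ∈ L, (cnt t L (x % t) : ℤ) := by
    have e1 : ∑ x ∈ L, ((L.filter fun y => y < x ∧ y % t = x % t).card : ℤ) =
        ∑ x ∈ L, ((L.filter fun y => x < y ∧ y % t = x % t).card : ℤ) := by
      simp only [Finset.card_filter]
      push_cast
      rw [Finset.sum_comm]
      refine Finset.sum_congr rfl fun x _ => Finset.sum_congr rfl fun y _ => ?_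
      simp only [eq_comm]
    rw [two_mul]
    nth_rewrite 2 [e1]
    rw [Finset.card_eq_sum_ones, Nat.cast_sum, ← Finset.sum_add_distrib, ← Finset.sum_add_distrib]
    refine Finset.sum_congr rfl fun x hx => ?_
    have e2 : L.filter (fun y => y % t = x % t) = ((L.filter fun y => y < x ∧ y % t = x % t) ∪
       (L.filter fun y => x < y ∧ y % t = x % t)) ∪ {x} := by
      ext y
      simp only [Finset.mem_union, Finset.mem_filter, Finset.mem_singleton]
      constructor
      · rintro ⟨a, b⟩
        rcases lt_trichotomy y x with h | h | h <;> tauto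
      · rintro ((h | h) | h)
        · tauto
        · tauto
        · rw [h]; tauto
    rw [cnt, e2, Finset.card_union_of_disjoint, Finset.card_union_of_disjoint]
    · simp
    · rw [Finset.disjoint_left]
      intro y hy hy'
      simp only [Finset.mem_filter] at hy hy'
      omega
    · rw [Finset.disjoint_left]
      intro y hy hy'
      simp only [Finset.mem_filter, Finset.mem_union, Finset.mem_singleton] at hy hy'
      omega
  have h4 : ((HH t L).card : ℤ) = ∑ x ∈ L, (((cls t x).filter fun y => y ∉ L).card : ℤ) := by
    rw [h1]; push_cast; rfl
  have h5 := Finset.sum_congr (rfl : L = L) h2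
  rw [Finset.sum_add_distrib, ← Finset.mul_sum, Finset.sum_add_distrib, ← h4,
    sum_mod_fiber t ht L (fun r => (r : ℤ))] at h5
  rw [sum_mod_fiber t ht L (fun r => (cnt t L r : ℤ))] at h3
  have h6 := sum_mod_fiber t ht L (fun r => 1)
  simp only [Finset.sum_const, nsmul_eq_mul, mul_one] at h6
  rw [h6] at h3
  rw [h5]
  have h7 : ∑ r ∈ Finset.range t, ((cnt t L r : ℤ) * (2 * r) + t * ((cnt t L r : ℤ) ^ 2 - cnt t L r)) =
     2 * ∑ r ∈ Finset.range t, (cnt t L r : ℤ) * r + t * (∑ r ∈ Finset.range t, (cnt t L r : ℤ) * cnt t L r -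
       ∑ r ∈ Finset.range t, (cnt t L r : ℤ)) := by
    rw [Finset.mul_sum, ← Finset.sum_sub_distrib, Finset.mul_sum, ← Finset.sum_add_distrib]
    refine Finset.sum_congr rfl fun r _ => ?_
    ring
  rw [h7, ← h3]
  ring

theorem cnt_range (t m r : ℕ) (hr : r < t) : cnt t (Finset.range (m * t)) r = m := by
  have ht : 0 < t := by omega
  have : (Finset.range (m * t)).filter (fun l => l % t = r) = cls t (r + t * m) := by
    ext y
    rw [mem_cls t _ ht, Finset.mem_filter, Finset.mem_range, Nat.add_mul_mod_self_left, Nat.mod_eq_of_lt hr]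
    refine and_congr_left fun h => ?_
    have hy := Nat.div_add_mod y t
    rw [h, mul_comm t (y / t)] at hy
    rw [← hy, mul_comm t m]
    constructor
    · intro; omega
    · intro h'
      have : y / t * t < m * t := by omega
      have := Nat.lt_of_mul_lt_mul_right this
      nlinarith
  rw [cnt, this, cls_card t _ ht, Nat.add_mul_div_left _ _ ht, Nat.div_eq_of_lt hr, zero_add]

theorem HH_range (t N : ℕ) : HH t (Finset.range N) = ∅ := by
  ext p
  rw [mem_HH]
  simp only [Finset.mem_range, Finset.notMem_empty, iff_false]
  omega

theorem energy (t m : ℕ) (ht : 0 < t) (L : Finset ℕ) (hL : L.card = m * t) :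
    (∑ x ∈ L, (x : ℤ) - ∑ k ∈ Finset.range (m * t), (k : ℤ) = t * (HH t L).card) ↔
      ∀ r < t, cnt t L r = m := by
  have h1 := HH_energy t ht L
  have h2 := HH_energy t ht (Finset.range (m * t))
  rw [HH_range, Finset.card_empty] at h2
  have h3 : ∑ r ∈ Finset.range t, (cnt t L r : ℤ) = m * t := by
    have h6 := sum_mod_fiber t ht L (fun r => 1)
    simp only [Finset.sum_const, nsmul_eq_mul, mul_one] at h6
    rw [← h6, hL]
    push_cast
    ring
  have h4 : ∑ r ∈ Finset.range t, ((cnt t L r : ℤ) - m) = 0 := by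
    rw [Finset.sum_sub_distrib, h3]
    simp [mul_comm]
  have h5 : 2 * (∑ x ∈ L, (x : ℤ) - ∑ k ∈ Finset.range (m * t), (k : ℤ) - t * (HH t L).card) =
      ∑ r ∈ Finset.range t, ((2 * r - t + 1) * ((cnt t L r : ℤ) - m) + t * ((cnt t L r : ℤ) - m) ^ 2) := by
    have e : ∑ r ∈ Finset.range t, ((2 * r - t + 1) * ((cnt t L r : ℤ) - m) + t * ((cnt t L r : ℤ) - m) ^ 2) =
       ∑ r ∈ Finset.range t, ((cnt t L r : ℤ) * (2 * r) + t * ((cnt t L r : ℤ) ^ 2 - cnt t L r)) -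
       ∑ r ∈ Finset.range t, ((cnt t (Finset.range (m * t)) r : ℤ) * (2 * r) + t * ((cnt t (Finset.range (m * t)) r : ℤ) ^ 2 - cnt t (Finset.range (m * t)) r)) + (1 - 2 * t * m) * ∑ r ∈ Finset.range t, ((cnt t L r : ℤ) - m) := by
      rw [Finset.mul_sum, ← Finset.sum_sub_distrib, ← Finset.sum_add_distrib]
      refine Finset.sum_congr rfl fun r hr => ?_
      rw [cnt_range t m r (Finset.mem_range.1 hr)]
      ring
    rw [e, h4]
    linear_combination h2 - h1
  have h6 : ∀ r ∈ Finset.range t, |(cnt t L r : ℤ) - m| ≤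
      ((2 * r - t + 1) * ((cnt t L r : ℤ) - m) + t * ((cnt t L r : ℤ) - m) ^ 2) := by
    intro r hr
    rw [Finset.mem_range] at hr
    have hr' : (r : ℤ) + 1 ≤ t := by exact_mod_cast hr
    have hr0 : (0 : ℤ) ≤ r := by positivity
    generalize (cnt t L r : ℤ) - m = c
    rcases lt_trichotomy c 0 with h | h | h
    · rw [abs_of_neg h]
      nlinarith [mul_nonneg (by linarith : (0 : ℤ) ≤ t - r - 1) (by linarith : 0 ≤ -c), mul_nonneg (by linarith : (0 : ℤ) ≤ t) (mul_nonneg (by linarith : (0 : ℤ) ≤ -c) (by linarith : (0 : ℤ) ≤ -c - 1)), mul_nonneg hr0 (by linarith : 0 ≤ -c)]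
    · rw [h]; simp
    · rw [abs_of_pos h]
      nlinarith [mul_nonneg hr0 h.le, mul_nonneg (by linarith : (0 : ℤ) ≤ t) (mul_nonneg h.le (by linarith : (0 : ℤ) ≤ c - 1))]
  constructor
  · intro h r hr
    have h7 : ∑ r ∈ Finset.range t, |(cnt t L r : ℤ) - m| ≤ 0 := by
      refine (Finset.sum_le_sum h6).trans ?_
      rw [← h5, h]
      simp
    have h8 := (Finset.sum_eq_zero_iff_of_nonneg (fun r _ => abs_nonneg _)).1
      (le_antisymm h7 (Finset.sum_nonneg fun r _ => abs_nonneg _)) r (Finset.mem_range.2 hr)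
    rw [abs_eq_zero] at h8
    omega
  · intro h
    have : ∑ r ∈ Finset.range t, ((2 * r - t + 1) * ((cnt t L r : ℤ) - m) + t * ((cnt t L r : ℤ) - m) ^ 2) = 0 := by
      refine Finset.sum_eq_zero fun r hr => ?_
      rw [h r (Finset.mem_range.1 hr)]
      ring
    rw [this] at h5
    linarith

end HF

namespace HF

theorem gg_injOn (K N : ℕ) (hK : 2 * N ≤ K + 1) (P : Finset ℕ) :
    Set.InjOn (gg K P) (Finset.range N : Finset ℕ) := by
  intro a ha b hb h
  exact gg_inj K N hK P a b (by simpa using ha) (by simpa using hb) h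

theorem LL_card (K N : ℕ) (hK : 2 * N ≤ K + 1) (P : Finset ℕ) : (LL N K P).card = N := by
  rw [LL, Finset.card_image_of_injOn (gg_injOn K N hK P), Finset.card_range]

theorem cnt_gg (t K N r : ℕ) (P : Finset ℕ) (hPN : ∀ l ∈ P, l < N) :
    ((Finset.range N).filter fun l => gg K P l % t = r).card + (P.filter fun l => l % t = r).card =
    cnt t (Finset.range N) r + (P.filter fun l => (K - l) % t = r).card := by
  have hsub : P ⊆ Finset.range N := fun l hl => Finset.mem_range.2 (hPN l hl)
  rw [cnt]
  simp only [Finset.card_filter]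
  rw [← Finset.sum_sdiff hsub, ← Finset.sum_sdiff hsub (f := fun l => if l % t = r then 1 else 0)]
  have h1 : ∑ x ∈ Finset.range N \ P, (if gg K P x % t = r then 1 else 0) =
      ∑ x ∈ Finset.range N \ P, (if x % t = r then 1 else 0) := by
    refine Finset.sum_congr rfl fun x hx => ?_
    rw [gg, if_neg (Finset.mem_sdiff.1 hx).2]
  have h2 : ∑ x ∈ P, (if gg K P x % t = r then 1 else 0) =
      ∑ x ∈ P, (if (K - x) % t = r then 1 else 0) := by
    refine Finset.sum_congr rfl fun x hx => ?_
    rw [gg, if_pos hx]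
  rw [h1, h2]
  ring

theorem cnt_LL (t K N r : ℕ) (hK : 2 * N ≤ K + 1) (P : Finset ℕ) :
    cnt t (LL N K P) r = ((Finset.range N).filter fun l => gg K P l % t = r).card := by
  rw [cnt, LL, Finset.filter_image, Finset.card_image_of_injOn]
  exact (gg_injOn K N hK P).mono (Finset.coe_subset.2 (Finset.filter_subset _ _))

theorem bal_iff (t m N K : ℕ) (ht : 0 < t) (hN : N = m * t) (hK : 2 * N ≤ K + 1) (P : Finset ℕ)
    (hPN : ∀ l ∈ P, l < N) : Bal t K P ↔ ∀ r < t, cnt t (LL N K P) r = m := by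
  constructor
  · intro hb r hr
    have h := cnt_gg t K N r P hPN
    rw [← cnt_LL t K N r hK, hb r] at h
    rw [hN, cnt_range t m r hr] at h
    rw [hN]
    omega
  · intro h r
    by_cases hr : r < t
    · have h1 := cnt_gg t K N r P hPN
      rw [← cnt_LL t K N r hK, h r hr] at h1
      rw [hN, cnt_range t m r hr] at h1
      omega
    · rw [Finset.filter_false_of_mem, Finset.filter_false_of_mem]
      · intro x _ hx
        have := Nat.mod_lt (K - x) ht
        omega
      · intro x _ hx
        have := Nat.mod_lt x ht
        omega

theorem bal_of_det (t N K : ℕ) (P : Finset ℕ) (hPN : ∀ l ∈ P, l < N)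
    (h : (AA t N (fun l => gg K P l)).det ≠ 0) : Bal t K P := by
  rw [Matrix.det_apply] at h
  obtain ⟨τ, _, hτ⟩ := Finset.exists_ne_zero_of_sum_ne_zero h
  have h1 : ∀ i : Fin N, gg K P (τ i) % t = (i : ℕ) % t := by
    intro i
    by_contra hi
    apply hτ
    rw [Finset.prod_eq_zero (Finset.mem_univ i), smul_zero]
    simp only [AA, Matrix.of_apply]
    rw [if_neg hi]
  intro r
  have h2 := cnt_gg t K N r P hPN
  have h3 : ((Finset.range N).filter fun l => gg K P l % t = r).card = cnt t (Finset.range N) r := by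
    rw [cnt]
    simp only [Finset.card_filter]
    rw [← Fin.sum_univ_eq_sum_range (fun l => if gg K P l % t = r then 1 else 0),
      ← Fin.sum_univ_eq_sum_range (fun l => if l % t = r then 1 else 0), ← Equiv.sum_comp τ]
    simp only [h1]
  omega

theorem symcount (P : Finset ℕ) (R : ℕ → ℕ → Prop) [DecidableRel R]
    (hR : ∀ x ∈ P, ∀ y ∈ P, (R x y ↔ R y x)) :
    ∑ x ∈ P, ∑ y ∈ P, (if R x y then 1 else 0) =
      2 * ∑ x ∈ P, ∑ y ∈ P, (if x < y ∧ R x y then 1 else 0) + ∑ x ∈ P, (if R x x then 1 else 0) := by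
  have h1 : ∑ x ∈ P, ∑ y ∈ P, (if x < y ∧ R x y then 1 else 0) =
      ∑ x ∈ P, ∑ y ∈ P, (if y < x ∧ R x y then 1 else 0) := by
    rw [Finset.sum_comm]
    refine Finset.sum_congr rfl fun x hx => Finset.sum_congr rfl fun y hy => ?_
    simp only [hR x hx y hy]
  rw [two_mul]
  nth_rewrite 2 [h1]
  rw [← Finset.sum_add_distrib, ← Finset.sum_add_distrib]
  refine Finset.sum_congr rfl fun x hx => ?_
  have h2 : (if R x x then 1 else 0) = ∑ y ∈ P, (if y = x ∧ R x y then 1 else 0) := by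
    rw [Finset.sum_eq_single x]
    · simp
    · intro y _ hy
      simp [hy]
    · intro h; exact absurd hx h
  rw [h2, ← Finset.sum_add_distrib, ← Finset.sum_add_distrib]
  refine Finset.sum_congr rfl fun y _ => ?_
  by_cases h : R x y
  · rcases lt_trichotomy x y with h3 | h3 | h3
    · simp [h, h3, h3.not_gt, h3.ne']
    · subst h3; simp [h]
    · simp [h, h3, h3.not_gt, h3.ne]
  · simp [h]

theorem Hneg_card (t N K : ℕ) (hK : 2 * N ≤ K + 1) (hK2 : K ≤ 2 * N) (P : Finset ℕ)
    (hPN : ∀ l ∈ P, l < N) :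
    ((HH t (LL N K P)).filter fun p => p.1 + p.2 < K).card =
    ((P ×ˢ Finset.range N).filter fun k => k.1 < k.2 ∧ gg K P k.2 % t = k.1 % t).card := by
  symm
  refine Finset.card_bij (fun k _ => (gg K P k.2, k.1)) ?_ ?_ ?_
  · rintro ⟨l, l'⟩ h
    simp only [Finset.mem_filter, Finset.mem_product, Finset.mem_range] at h
    obtain ⟨⟨h1, h2⟩, h3, h4⟩ := h
    have hl := hPN l h1
    rw [Finset.mem_filter, mem_HH]
    refine ⟨⟨Finset.mem_image_of_mem _ (Finset.mem_range.2 h2), ?_, ?_, h4.symm⟩, ?_⟩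
    · show l ∉ LL N K P
      rw [LL, Finset.mem_image]
      rintro ⟨a, ha, ha'⟩
      rw [Finset.mem_range] at ha
      unfold gg at ha'
      split_ifs at ha' with h5
      · omega
      · rw [ha'] at h5; exact h5 h1
    · show l < gg K P l'
      unfold gg
      split_ifs <;> omega
    · show gg K P l' + l < K
      unfold gg
      split_ifs <;> omega
  · rintro ⟨a, b⟩ h ⟨a', b'⟩ h' heq
    simp only [Finset.mem_filter, Finset.mem_product, Finset.mem_range] at h h'
    rw [Prod.mk.injEq] at heq
    rw [Prod.mk.injEq]
    exact ⟨heq.2, gg_inj K N hK P b b' h.1.2 h'.1.2 heq.1⟩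
  · rintro ⟨x, y⟩ h
    rw [Finset.mem_filter, mem_HH] at h
    obtain ⟨⟨h1, h2, h3, h4⟩, h5⟩ := h
    simp only at h1 h2 h3 h4 h5
    rw [LL, Finset.mem_image] at h1
    obtain ⟨l', hl', rfl⟩ := h1
    rw [Finset.mem_range] at hl'
    have hy : y < N := by
      by_contra hy
      omega
    have hyP : y ∈ P := by
      by_contra hyP
      apply h2
      rw [LL, Finset.mem_image]
      exact ⟨y, Finset.mem_range.2 hy, by rw [gg, if_neg hyP]⟩
    refine ⟨(y, l'), ?_, rfl⟩
    simp only [Finset.mem_filter, Finset.mem_product, Finset.mem_range]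
    refine ⟨⟨hyP, hl'⟩, ?_, h4.symm⟩
    unfold gg at h3 h5
    split_ifs at h3 h5 <;> omega

theorem sign_eq (t N K : ℕ) (hK : 2 * N ≤ K + 1) (hK2 : K ≤ 2 * N) (P : Finset ℕ)
    (hPN : ∀ l ∈ P, l < N) (hb : Bal t K P) :
    (P.filter fun l => l % t ≠ (K - l) % t).card / 2 +
        ((Finset.range N ×ˢ Finset.range N).filter fun k => k.1 < k.2 ∧ k.1 % t = k.2 % t ∧ k.1 ∈ P).card =
    ((HH t (LL N K P)).filter fun p => p.1 + p.2 < K).card := by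
  have hP : ∀ l ∈ P, l ≤ K := fun l hl => by have := hPN l hl; omega
  have hsub : P ⊆ Finset.range N := fun l hl => Finset.mem_range.2 (hPN l hl)
  rw [Hneg_card t N K hK hK2 P hPN]
  have e1 : (P.filter fun l => l % t ≠ (K - l) % t).card + ∑ x ∈ P, (if (K - x) % t = x % t then 1 else 0) =
      P.card := by
    rw [← Finset.card_filter, add_comm]
    have := Finset.card_filter_add_card_filter_not (s := P) (fun x => (K - x) % t = x % t)
    rw [← this]
    simp only [ne_eq, eq_comm]
  have e2 := symcount P (fun x y => (K - y) % t = x % t) (fun x hx y hy => mod_flip t K y x (hP y hy) (hP x hx))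
  have e3 := symcount P (fun x y => y % t = x % t) (fun x hx y hy => eq_comm)
  have e4 : ∑ x ∈ P, ∑ y ∈ P, (if (K - y) % t = x % t then 1 else 0) =
      ∑ x ∈ P, ∑ y ∈ P, (if y % t = x % t then 1 else 0) := by
    refine Finset.sum_congr rfl fun x _ => ?_
    rw [← Finset.card_filter, ← Finset.card_filter, hb]
  have e5 : ((Finset.range N ×ˢ Finset.range N).filter fun k => k.1 < k.2 ∧ k.1 % t = k.2 % t ∧ k.1 ∈ P).card =
      ∑ x ∈ P, ∑ y ∈ Finset.range N \ P, (if x < y ∧ y % t = x % t then 1 else 0) +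
      ∑ x ∈ P, ∑ y ∈ P, (if x < y ∧ y % t = x % t then 1 else 0) := by
    have : ((Finset.range N ×ˢ Finset.range N).filter fun k => k.1 < k.2 ∧ k.1 % t = k.2 % t ∧ k.1 ∈ P) =
       (P ×ˢ Finset.range N).filter fun k => k.1 < k.2 ∧ k.2 % t = k.1 % t := by
      ext ⟨a, b⟩
      simp only [Finset.mem_filter, Finset.mem_product, Finset.mem_range]
      constructor
      · rintro ⟨⟨h1, h2⟩, h3, h4, h5⟩
        exact ⟨⟨h5, h2⟩, h3, h4.symm⟩
      · rintro ⟨⟨h1, h2⟩, h3, h4⟩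
        exact ⟨⟨hPN _ h1, h2⟩, h3, h4.symm, h1⟩
    rw [this, Finset.card_filter, Finset.sum_product, ← Finset.sum_add_distrib]
    refine Finset.sum_congr rfl fun x _ => ?_
    rw [Finset.sum_sdiff hsub]
  have e6 : ((P ×ˢ Finset.range N).filter fun k => k.1 < k.2 ∧ gg K P k.2 % t = k.1 % t).card =
      ∑ x ∈ P, ∑ y ∈ Finset.range N \ P, (if x < y ∧ y % t = x % t then 1 else 0) +
      ∑ x ∈ P, ∑ y ∈ P, (if x < y ∧ (K - y) % t = x % t then 1 else 0) := by
    rw [Finset.card_filter, Finset.sum_product, ← Finset.sum_add_distrib]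
    refine Finset.sum_congr rfl fun x _ => ?_
    rw [← Finset.sum_sdiff hsub]
    congr 1
    · refine Finset.sum_congr rfl fun y hy => ?_
      rw [gg, if_neg (Finset.mem_sdiff.1 hy).2]
    · refine Finset.sum_congr rfl fun y hy => ?_
      rw [gg, if_pos hy]
  rw [e5, e6]
  rw [e4, e3] at e2
  have e7 : ∑ x ∈ P, (if x % t = x % t then 1 else 0) = P.card := by simp
  rw [e7] at e2
  omega

/-- the sign of a hook pair -/
def eps (K : ℕ) (p : ℕ × ℕ) : ℚ := if p.1 + p.2 < K then -1 else 1

theorem term_eval (t m N K n : ℕ) (ht : 0 < t) (hN : N = m * t) (hK : 2 * N ≤ K + 1) (hK2 : K ≤ 2 * N)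
    (P : Finset ℕ) (hPN : ∀ l ∈ P, l < N) :
    coeff n (Matrix.of fun l k : Fin N => hh t ((gg K P l : ℤ) - ((k : ℕ) : ℤ))).det =
    if ∑ x ∈ LL N K P, (x : ℤ) - ∑ k ∈ Finset.range N, (k : ℤ) = t * n ∧ (HH t (LL N K P)).card = n then
      ∏ p ∈ HH t (LL N K P), (t : ℚ) / (((p.1 : ℚ) - (p.2 : ℚ)) * eps K p) else 0 := by
  rw [coeff_det_hh t N n ht (fun l => gg K P l)]
  have hen := energy t m ht (LL N K P) (by rw [LL_card K N hK, hN])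
  rw [← bal_iff t m N K ht hN hK P hPN, ← hN] at hen
  have ht' : (t : ℤ) ≠ 0 := by exact_mod_cast ht.ne'
  by_cases hb : Bal t K P
  · have hE := hen.2 hb
    have hc := (bal_iff t m N K ht hN hK P hPN).1 hb
    have hdet := det_AA_gg t m N K ht hN hK P hPN hb
    have hS : (∑ l : Fin N, (gg K P l) / t = n + ∑ k : Fin N, (k : ℕ) / t) ↔ (HH t (LL N K P)).card = n := by
      have h1 : ∑ x ∈ LL N K P, (x : ℤ) = t * (∑ l : Fin N, gg K P l / t : ℕ) +
          ∑ r ∈ Finset.range t, (m : ℤ) * r := by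
        have e1 : ∑ x ∈ LL N K P, (x : ℤ) = ∑ x ∈ LL N K P, ((t : ℤ) * (x / t : ℕ) + (x % t : ℕ)) :=
          Finset.sum_congr rfl fun x _ => by exact_mod_cast (Nat.div_add_mod x t).symm
        rw [e1, Finset.sum_add_distrib, sum_mod_fiber t ht _ (fun r => (r : ℤ)), ← Finset.mul_sum]
        congr 1
        · rw [Fin.sum_univ_eq_sum_range (fun l => gg K P l / t), LL, Finset.sum_image (gg_injOn K N hK P)]
          push_cast
          rfl
        · refine Finset.sum_congr rfl fun r hr => ?_
          rw [hc r (Finset.mem_range.1 hr)]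
      have h2 : ∑ x ∈ Finset.range N, (x : ℤ) = t * (∑ l : Fin N, (l : ℕ) / t : ℕ) +
          ∑ r ∈ Finset.range t, (m : ℤ) * r := by
        have e1 : ∑ x ∈ Finset.range N, (x : ℤ) = ∑ x ∈ Finset.range N, ((t : ℤ) * (x / t : ℕ) + (x % t : ℕ)) :=
          Finset.sum_congr rfl fun x _ => by exact_mod_cast (Nat.div_add_mod x t).symm
        rw [e1, Finset.sum_add_distrib, sum_mod_fiber t ht _ (fun r => (r : ℤ)), ← Finset.mul_sum]
        congr 1
        · rw [Fin.sum_univ_eq_sum_range (fun l => l / t)]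
          push_cast
          rfl
        · refine Finset.sum_congr rfl fun r hr => ?_
          rw [hN, cnt_range t m r (Finset.mem_range.1 hr)]
      rw [h1, h2] at hE
      have h3 : (t : ℤ) * ((∑ l : Fin N, gg K P l / t : ℕ) - (∑ l : Fin N, (l : ℕ) / t : ℕ)) =
        t * (HH t (LL N K P)).card := by linear_combination hE
      have h4 := mul_left_cancel₀ ht' h3
      omega
    have hif : (∑ x ∈ LL N K P, (x : ℤ) - ∑ k ∈ Finset.range N, (k : ℤ) = t * n ∧ (HH t (LL N K P)).card = n) ↔
        (HH t (LL N K P)).card = n := by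
      constructor
      · exact fun h => h.2
      · intro h
        refine ⟨?_, h⟩
        rw [hE, h]
    simp only [hS, hif]
    congr 1
    rw [hdet, sign_eq t N K hK hK2 P hPN hb]
    have h5 : ∏ p ∈ HH t (LL N K P), (t : ℚ) / (((p.1 : ℚ) - (p.2 : ℚ)) * eps K p) =
        (∏ p ∈ HH t (LL N K P), eps K p) * ∏ p ∈ HH t (LL N K P), (t : ℚ) / ((p.1 : ℚ) - (p.2 : ℚ)) := by
      rw [← Finset.prod_mul_distrib]
      refine Finset.prod_congr rfl fun p _ => ?_
      unfold eps
      split_ifs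
      · rw [mul_neg_one, div_neg]; ring
      · ring
    have h6 : ∏ p ∈ HH t (LL N K P), eps K p =
        (-1) ^ ((HH t (LL N K P)).filter fun p => p.1 + p.2 < K).card := by
      unfold eps
      rw [← Finset.prod_filter, Finset.prod_const]
    rw [h5, h6, ← HH_prod t ht]
    have h7 : ∏ l : Fin N, ((gg K P l / t).factorial : ℚ)⁻¹ = ∏ x ∈ LL N K P, ((x / t).factorial : ℚ)⁻¹ := by
      rw [Fin.prod_univ_eq_prod_range (fun l => ((gg K P l / t).factorial : ℚ)⁻¹), LL,
        Finset.prod_image (gg_injOn K N hK P)]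
    rw [h7]
    ring
  · have hdet : (AA t N (fun l => gg K P l)).det = 0 := by
      by_contra h
      exact hb (bal_of_det t N K P hPN h)
    rw [hdet, mul_zero, ite_self, if_neg]
    rintro ⟨h1, h2⟩
    apply hb
    rw [← hen, h1, h2]

end HF

namespace HF

/-- beads of a diagram -/
def ell (N : ℕ) (μ : YoungDiagram) (i : ℕ) : ℕ := μ.rowLen i + (N - 1 - i)

/-- gaps of a diagram -/
def yy (N : ℕ) (μ : YoungDiagram) (j : ℕ) : ℕ := N + j - μ.colLen j

/-- the bead set of a diagram -/
def Lmu (N : ℕ) (μ : YoungDiagram) : Finset ℕ := (Finset.range N).image (ell N μ)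

theorem lt_col_iff_lt_row (μ : YoungDiagram) (i j : ℕ) : i < μ.colLen j ↔ j < μ.rowLen i := by
  rw [← YoungDiagram.mem_iff_lt_colLen, YoungDiagram.mem_iff_lt_rowLen]

theorem colLen_le (N : ℕ) (μ : YoungDiagram) (h : μ.colLen 0 ≤ N) (j : ℕ) : μ.colLen j ≤ N :=
  (μ.colLen_anti 0 j (Nat.zero_le j)).trans h

theorem rowLen_zero_of (N : ℕ) (μ : YoungDiagram) (h : μ.colLen 0 ≤ N) (i : ℕ) (hi : N ≤ i) : μ.rowLen i = 0 := by
  by_contra h0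
  have : i < μ.colLen 0 := (lt_col_iff_lt_row μ i 0).2 (Nat.pos_of_ne_zero h0)
  omega

theorem ell_anti (N : ℕ) (μ : YoungDiagram) (i i' : ℕ) (h : i < i') (hi' : i' < N) : ell N μ i' < ell N μ i := by
  have := μ.rowLen_anti i i' h.le
  unfold ell
  omega

theorem ell_injOn (N : ℕ) (μ : YoungDiagram) : Set.InjOn (ell N μ) (Finset.range N : Finset ℕ) := by
  intro a ha b hb h
  simp only [Finset.coe_range, Set.mem_Iio] at ha hb
  rcases lt_trichotomy a b with h1 | h1 | h1
  · have := ell_anti N μ a b h1 hb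
    omega
  · exact h1
  · have := ell_anti N μ b a h1 ha
    omega

theorem yy_mono (N : ℕ) (μ : YoungDiagram) (h : μ.colLen 0 ≤ N) (j j' : ℕ) (hj : j < j') : yy N μ j < yy N μ j' := by
  have h1 := μ.colLen_anti j j' hj.le
  have h2 := colLen_le N μ h j
  unfold yy
  omega

theorem yy_smono (N : ℕ) (μ : YoungDiagram) (h : μ.colLen 0 ≤ N) : StrictMono (yy N μ) :=
  fun j j' hj => yy_mono N μ h j j' hj

theorem cell_gt (N : ℕ) (μ : YoungDiagram) (h : μ.colLen 0 ≤ N) (i j : ℕ) (hij : j < μ.rowLen i) :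
    yy N μ j < ell N μ i ∧ ell N μ i - yy N μ j = hookLen μ (i, j) := by
  have h1 := (lt_col_iff_lt_row μ i j).2 hij
  have h2 := colLen_le N μ h j
  unfold ell yy hookLen
  simp only
  omega

theorem notcell_lt (N : ℕ) (μ : YoungDiagram) (i j : ℕ) (hi : i < N) (hij : ¬ j < μ.rowLen i) :
    ell N μ i < yy N μ j := by
  have h1 := mt (lt_col_iff_lt_row μ i j).1 hij
  unfold ell yy
  omega

theorem yy_notMem (N : ℕ) (μ : YoungDiagram) (h : μ.colLen 0 ≤ N) (j : ℕ) : yy N μ j ∉ Lmu N μ := by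
  rw [Lmu, Finset.mem_image]
  rintro ⟨i, hi, he⟩
  rw [Finset.mem_range] at hi
  by_cases hij : j < μ.rowLen i
  · have := (cell_gt N μ h i j hij).1
    omega
  · have := notcell_lt N μ i j hi hij
    omega

theorem hole_exists (N : ℕ) (μ : YoungDiagram) (h : μ.colLen 0 ≤ N) (y : ℕ) (hy : y ∉ Lmu N μ) :
    ∃ j, yy N μ j = y := by
  have hex : ∃ i, i = N ∨ ell N μ i < y := ⟨N, Or.inl rfl⟩
  classical
  let i0 := Nat.find hex
  have hs : i0 = N ∨ ell N μ i0 < y := Nat.find_spec hex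
  have hm : ∀ i < i0, ¬ (i = N ∨ ell N μ i < y) := fun i hi => Nat.find_min hex hi
  have hle : i0 ≤ N := Nat.find_min' hex (Or.inl rfl)
  have hgt : ∀ i < i0, y < ell N μ i := by
    intro i hi
    have h1 := hm i hi
    push Not at h1
    refine lt_of_le_of_ne h1.2 ?_
    rintro rfl
    exact hy (Finset.mem_image_of_mem _ (Finset.mem_range.2 (by omega)))
  have hge : N ≤ y + i0 := by
    rcases hs with h1 | h1
    · omega
    · unfold ell at h1
      omega
  refine ⟨y + i0 - N, ?_⟩
  have hcol : μ.colLen (y + i0 - N) = i0 := by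
    apply le_antisymm
    · by_contra hc
      push Not at hc
      have h1 := (lt_col_iff_lt_row μ i0 _).1 hc
      rcases hs with h2 | h2
      · have := rowLen_zero_of N μ h i0 h2.ge
        omega
      · unfold ell at h2
        omega
    · by_contra hc
      push Not at hc
      have h1 := hgt (i0 - 1) (by omega)
      have h2 : ¬ (i0 - 1 < μ.colLen (y + i0 - N)) := by omega
      rw [lt_col_iff_lt_row] at h2
      unfold ell at h1
      omega
  unfold yy
  rw [hcol]
  omega

theorem hook_bij {N : ℕ} {μ : YoungDiagram} (h : μ.colLen 0 ≤ N) (t : ℕ) :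
    HH t (Lmu N μ) = (μ.cells.filter fun c => t ∣ hookLen μ c).image (fun c => (ell N μ c.1, yy N μ c.2)) := by
  have key : ∀ i j, j < μ.rowLen i → (yy N μ j % t = ell N μ i % t ↔ t ∣ hookLen μ (i, j)) := by
    intro i j hij
    obtain ⟨h1, h2⟩ := cell_gt N μ h i j hij
    rw [← h2]
    exact Nat.modEq_iff_dvd' h1.le
  ext ⟨x, y⟩
  rw [mem_HH, Finset.mem_image]
  constructor
  · rintro ⟨h1, h2, h3, h4⟩
    simp only at h1 h2 h3 h4
    rw [Lmu, Finset.mem_image] at h1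
    obtain ⟨i, hi, rfl⟩ := h1
    obtain ⟨j, rfl⟩ := hole_exists N μ h y h2
    rw [Finset.mem_range] at hi
    have hij : j < μ.rowLen i := by
      by_contra hij
      have := notcell_lt N μ i j hi hij
      omega
    refine ⟨(i, j), ?_, rfl⟩
    rw [Finset.mem_filter]
    exact ⟨(YoungDiagram.mem_cells _).2 (YoungDiagram.mem_iff_lt_rowLen.2 hij), (key i j hij).1 h4⟩
  · rintro ⟨⟨i, j⟩, hc, he⟩
    rw [Finset.mem_filter, YoungDiagram.mem_cells, YoungDiagram.mem_iff_lt_rowLen] at hc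
    rw [Prod.mk.injEq] at he
    obtain ⟨h1, h2⟩ := hc
    obtain ⟨rfl, rfl⟩ := he
    have hi : i < N := by
      by_contra hi
      have := rowLen_zero_of N μ h i (by omega)
      omega
    exact ⟨Finset.mem_image_of_mem _ (Finset.mem_range.2 hi), yy_notMem N μ h j, (cell_gt N μ h i j h1).1,
      (key i j h1).2 h2⟩

theorem hook_inj {N : ℕ} {μ : YoungDiagram} (h : μ.colLen 0 ≤ N) :
    Set.InjOn (fun c : ℕ × ℕ => (ell N μ c.1, yy N μ c.2)) (μ.cells : Finset (ℕ × ℕ)) := by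
  rintro ⟨i, j⟩ hc ⟨i', j'⟩ hc' he
  rw [Finset.mem_coe, YoungDiagram.mem_cells, YoungDiagram.mem_iff_lt_rowLen] at hc hc'
  simp only [Prod.mk.injEq] at he
  have hi : i < N := by
    by_contra hi
    have := rowLen_zero_of N μ h i (by omega)
    omega
  have hi' : i' < N := by
    by_contra hi
    have := rowLen_zero_of N μ h i' (by omega)
    omega
  rw [Prod.mk.injEq]
  exact ⟨ell_injOn N μ (by simpa using hi) (by simpa using hi') he.1, (yy_smono N μ h).injective he.2⟩

theorem card_mu {N : ℕ} {μ : YoungDiagram} (h : μ.colLen 0 ≤ N) :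
    ∑ x ∈ Lmu N μ, (x : ℤ) - ∑ k ∈ Finset.range N, (k : ℤ) = μ.card := by
  rw [Lmu, Finset.sum_image (ell_injOn N μ), ← Finset.sum_range_reflect (fun k => (k : ℤ)),
    ← Finset.sum_sub_distrib]
  have h1 : μ.card = ∑ i ∈ Finset.range N, μ.rowLen i := by
    have := Finset.sum_finset_product μ.cells (Finset.range N) (fun i => Finset.range (μ.rowLen i))
      (fun p => by
        rw [YoungDiagram.mem_cells, YoungDiagram.mem_iff_lt_rowLen (i := p.1) (j := p.2), Finset.mem_range,
          Finset.mem_range]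
        constructor
        · intro hp
          refine ⟨?_, hp⟩
          by_contra hi
          have := rowLen_zero_of N μ h p.1 (by omega)
          omega
        · exact fun hp => hp.2) (f := fun _ => 1)
    simpa using this
  rw [h1]
  push_cast
  refine Finset.sum_congr rfl fun i _ => ?_
  unfold ell
  push_cast
  ring

/-- the generalised diagonal condition -/
def Diag (e : ℕ) (μ : YoungDiagram) : Prop := ∀ i : ℕ, (i, i) ∈ μ → μ.rowLen i = μ.colLen i + e

/-- missing beads -/
def Pmu (N : ℕ) (μ : YoungDiagram) : Finset ℕ := Finset.range N \ Lmu N μ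

theorem eps_eq {N e : ℕ} {μ : YoungDiagram} (h : μ.colLen 0 ≤ N) (hD : Diag e μ) (K : ℕ) (hK : K + 1 = 2 * N + e)
    (c : ℕ × ℕ) (hc : c ∈ μ) : eps K (ell N μ c.1, yy N μ c.2) = epsQ c := by
  obtain ⟨i, j⟩ := c
  have hij := YoungDiagram.mem_iff_lt_rowLen.1 hc
  have hji := (lt_col_iff_lt_row μ i j).2 hij
  have hcol := colLen_le N μ h j
  unfold eps epsQ
  simp only
  congr 1
  apply propext
  unfold ell yy
  constructor
  · intro hlt
    by_contra hle
    push Not at hle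
    have h1 : (i, i) ∈ μ := YoungDiagram.mem_iff_lt_rowLen.2 (by omega)
    have h2 := hD i h1
    have h3 := μ.colLen_anti i j hle
    omega
  · intro hlt
    by_cases h1 : (i, i) ∈ μ
    · have h2 := hD i h1
      have h3 := μ.colLen_anti j i hlt.le
      omega
    · have h2 := mt YoungDiagram.mem_iff_lt_rowLen.2 h1
      omega

theorem Pmu_eq {N : ℕ} {μ : YoungDiagram} (h : μ.colLen 0 ≤ N) :
    Pmu N μ = (μ.cells.filter fun c => c.1 = c.2).image (fun c => yy N μ c.1) := by
  ext y
  rw [Pmu, Finset.mem_sdiff, Finset.mem_range, Finset.mem_image]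
  constructor
  · rintro ⟨h1, h2⟩
    obtain ⟨j, rfl⟩ := hole_exists N μ h y h2
    refine ⟨(j, j), ?_, rfl⟩
    rw [Finset.mem_filter, YoungDiagram.mem_cells, YoungDiagram.mem_iff_lt_colLen]
    refine ⟨?_, rfl⟩
    unfold yy at h1
    omega
  · rintro ⟨⟨i, j⟩, hc, rfl⟩
    rw [Finset.mem_filter, YoungDiagram.mem_cells, YoungDiagram.mem_iff_lt_colLen] at hc
    obtain ⟨h1, h2⟩ := hc
    simp only at h2
    subst h2
    refine ⟨?_, yy_notMem N μ h _⟩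
    have := colLen_le N μ h i
    show yy N μ i < N
    unfold yy
    omega

theorem Pmu_card {N : ℕ} {μ : YoungDiagram} (h : μ.colLen 0 ≤ N) : (Pmu N μ).card = durfee μ := by
  rw [Pmu_eq h, durfee, Finset.card_image_of_injOn]
  rintro ⟨i, j⟩ hc ⟨i', j'⟩ hc' he
  rw [Finset.mem_coe, Finset.mem_filter] at hc hc'
  have h3 := (yy_smono N μ h).injective he
  simp only at h3
  rw [Prod.mk.injEq]
  omega

theorem LL_Pmu {N e : ℕ} {μ : YoungDiagram} (h : μ.colLen 0 ≤ N) (hD : Diag e μ) (K : ℕ) (hK : K + 1 = 2 * N + e) :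
    LL N K (Pmu N μ) = Lmu N μ := by
  refine Finset.eq_of_subset_of_card_le ?_ ?_
  · intro x hx
    rw [LL, Finset.mem_image] at hx
    obtain ⟨l, hl, rfl⟩ := hx
    unfold gg
    split_ifs with hP
    · rw [Pmu_eq h, Finset.mem_image] at hP
      obtain ⟨⟨i, j⟩, hc, rfl⟩ := hP
      rw [Finset.mem_filter, YoungDiagram.mem_cells] at hc
      obtain ⟨h1, h2⟩ := hc
      simp only at h2
      subst h2
      have h3 := hD i h1
      have h4 := colLen_le N μ h i
      rw [YoungDiagram.mem_iff_lt_colLen] at h1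
      rw [Lmu, Finset.mem_image]
      refine ⟨i, Finset.mem_range.2 (by omega), ?_⟩
      unfold ell yy
      simp only
      omega
    · rw [Pmu, Finset.mem_sdiff, not_and, not_not] at hP
      exact hP hl
  · rw [LL_card K N (by omega), Lmu, Finset.card_image_of_injOn (ell_injOn N μ), Finset.card_range]

end HF

namespace HF

theorem mu_ext (N : ℕ) (μ ν : YoungDiagram) (hμ : μ.colLen 0 ≤ N) (hν : ν.colLen 0 ≤ N)
    (h : Lmu N μ = Lmu N ν) : μ = ν := by
  have hc : ∀ ρ : YoungDiagram, (Lmu N ρ).card = N := fun ρ => by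
    rw [Lmu, Finset.card_image_of_injOn (ell_injOn N ρ), Finset.card_range]
  have hu : ∀ ρ : YoungDiagram, Lmu N ρ = Lmu N μ →
      (fun i : Fin N => ell N ρ (N - 1 - i)) = (Lmu N μ).orderEmbOfFin (hc μ) := by
    intro ρ hρ
    refine Finset.orderEmbOfFin_unique (hc μ) ?_ ?_
    · intro i
      rw [← hρ]
      exact Finset.mem_image_of_mem _ (Finset.mem_range.2 (by have := i.2; omega))
    · intro i j hij
      have hi := i.2
      have hj := j.2
      have : (i : ℕ) < j := hij
      exact ell_anti N ρ _ _ (by omega) (by omega)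
  have h1 := (hu μ rfl).trans (hu ν h.symm).symm
  have h2 : ∀ i, μ.rowLen i = ν.rowLen i := by
    intro i
    by_cases hi : i < N
    · have h3 := congrFun h1 ⟨N - 1 - i, by omega⟩
      simp only at h3
      have h4 : N - 1 - (N - 1 - i) = i := by omega
      rw [h4] at h3
      unfold ell at h3
      omega
    · rw [rowLen_zero_of N μ hμ i (by omega), rowLen_zero_of N ν hν i (by omega)]
  apply YoungDiagram.ext
  ext ⟨i, j⟩
  rw [YoungDiagram.mem_cells, YoungDiagram.mem_cells, YoungDiagram.mem_iff_lt_rowLen,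
    YoungDiagram.mem_iff_lt_rowLen, h2]

theorem exists_mu (N : ℕ) (L : Finset ℕ) (hL : L.card = N) :
    ∃ μ : YoungDiagram, μ.colLen 0 ≤ N ∧ Lmu N μ = L := by
  let F : ℕ → ℕ := fun k => if h : k < N then L.orderEmbOfFin hL ⟨k, h⟩ else 0
  have hF : ∀ k (h : k < N), F k = L.orderEmbOfFin hL ⟨k, h⟩ := fun k h => dif_pos h
  have hstep : ∀ d k, k + d < N → F k + d ≤ F (k + d) := by
    intro d
    induction d with
    | zero => intro k _; exact le_rfl
    | succ d ih =>
      intro k hk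
      have h1 := ih k (by omega)
      have h2 : F (k + d) < F (k + (d + 1)) := by
        rw [hF _ (by omega), hF _ hk]
        apply (L.orderEmbOfFin hL).strictMono
        show k + d < k + (d + 1)
        omega
      omega
  let ρ : ℕ → ℕ := fun i => F (N - 1 - i) - (N - 1 - i)
  have hρ : ∀ i i', i ≤ i' → i' < N → ρ i' ≤ ρ i := by
    intro i i' h1 h2
    have h3 := hstep (i' - i) (N - 1 - i') (by omega)
    have h4 : N - 1 - i' + (i' - i) = N - 1 - i := by omega
    rw [h4] at h3
    show F (N - 1 - i') - (N - 1 - i') ≤ F (N - 1 - i) - (N - 1 - i)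
    omega
  let μ : YoungDiagram :=
    { cells := (Finset.range N).biUnion fun i => (Finset.range (ρ i)).image fun j => (i, j)
      isLowerSet := by
        rintro ⟨i, j⟩ ⟨i', j'⟩ hle hm
        simp only [Finset.coe_biUnion, Finset.coe_image, Set.mem_iUnion, Finset.mem_coe, Set.mem_image,
          Finset.mem_range, Prod.mk.injEq] at hm ⊢
        obtain ⟨a, ha, b, hb, rfl, rfl⟩ := hm
        have h1 : i' ≤ a := hle.1
        have h2 : j' ≤ b := hle.2
        exact ⟨i', by omega, j', by have := hρ i' a h1 ha; omega, rfl, rfl⟩ }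
  have hmem : ∀ i j, (i, j) ∈ μ ↔ i < N ∧ j < ρ i := by
    intro i j
    rw [← YoungDiagram.mem_cells]
    simp only [μ, Finset.mem_biUnion, Finset.mem_image, Finset.mem_range, Prod.mk.injEq]
    constructor
    · rintro ⟨a, ha, b, hb, rfl, rfl⟩
      exact ⟨ha, hb⟩
    · rintro ⟨ha, hb⟩
      exact ⟨i, ha, j, hb, rfl, rfl⟩
  have hrow : ∀ i < N, μ.rowLen i = ρ i := by
    intro i hi
    have h1 := hmem i (μ.rowLen i)
    have h2 := hmem i (ρ i)
    rw [YoungDiagram.mem_iff_lt_rowLen] at h1 h2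
    omega
  refine ⟨μ, ?_, ?_⟩
  · by_contra hc
    push Not at hc
    have := (hmem N 0).1 (YoungDiagram.mem_iff_lt_colLen.2 hc)
    omega
  · refine Finset.eq_of_subset_of_card_le ?_ ?_
    · intro x hx
      rw [Lmu, Finset.mem_image] at hx
      obtain ⟨i, hi, rfl⟩ := hx
      rw [Finset.mem_range] at hi
      have h1 := hstep (N - 1 - i) 0 (by omega)
      rw [zero_add] at h1
      have h2 : ell N μ i = F (N - 1 - i) := by
        unfold ell
        rw [hrow i hi]
        show F (N - 1 - i) - (N - 1 - i) + (N - 1 - i) = _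
        omega
      rw [h2, hF _ (by omega)]
      exact Finset.orderEmbOfFin_mem _ _ _
    · rw [hL, Lmu, Finset.card_image_of_injOn (ell_injOn N μ), Finset.card_range]

theorem mem_LL (N K : ℕ) (hK : 2 * N ≤ K + 1) (P : Finset ℕ) (hPN : ∀ l ∈ P, l < N) (x : ℕ) :
    x ∈ LL N K P ↔ (x < N ∧ x ∉ P) ∨ (x ≤ K ∧ K - x ∈ P) := by
  rw [LL, Finset.mem_image]
  constructor
  · rintro ⟨l, hl, rfl⟩
    rw [Finset.mem_range] at hl
    unfold gg
    split_ifs with h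
    · right
      refine ⟨by omega, ?_⟩
      rwa [Nat.sub_sub_self (by omega)]
    · exact Or.inl ⟨hl, h⟩
  · rintro (⟨h1, h2⟩ | ⟨h1, h2⟩)
    · exact ⟨x, Finset.mem_range.2 h1, by rw [gg, if_neg h2]⟩
    · refine ⟨K - x, Finset.mem_range.2 (hPN _ h2), ?_⟩
      rw [gg, if_pos h2]
      omega

theorem exists_diag (N e K : ℕ) (hK : K + 1 = 2 * N + e) (P : Finset ℕ) (hPN : ∀ l ∈ P, l < N) :
    ∃ μ : YoungDiagram, μ.colLen 0 ≤ N ∧ Diag e μ ∧ Pmu N μ = P := by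
  have hK1 : 2 * N ≤ K + 1 := by omega
  obtain ⟨μ, h, hL⟩ := exists_mu N (LL N K P) (LL_card K N hK1 P)
  have hmem := mem_LL N K hK1 P hPN
  refine ⟨μ, h, ?_, ?_⟩
  · intro i hi
    have hr := YoungDiagram.mem_iff_lt_rowLen.1 hi
    have hcl := YoungDiagram.mem_iff_lt_colLen.1 hi
    have hcN := colLen_le N μ h i
    have hiN : i < N := by omega
    have hell : N ≤ ell N μ i := by unfold ell; omega
    have hiL : ell N μ i ∈ LL N K P := by
      rw [← hL]
      exact Finset.mem_image_of_mem _ (Finset.mem_range.2 hiN)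
    have h1 : ell N μ i ≤ K ∧ K - ell N μ i ∈ P := by
      rcases (hmem _).1 hiL with h2 | h2
      · omega
      · exact h2
    have h2 : K - ell N μ i ∉ Lmu N μ := by
      rw [hL, hmem]
      have h3 := hPN _ h1.2
      rintro (h4 | h4)
      · exact h4.2 h1.2
      · have := hPN _ h4.2
        omega
    obtain ⟨j, hj⟩ := hole_exists N μ h _ h2
    have hA : ((LL N K P).filter fun x => ell N μ i < x) = (Finset.range i).image (ell N μ) := by
      rw [← hL]
      ext x
      rw [Finset.mem_filter, Lmu, Finset.mem_image, Finset.mem_image]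
      constructor
      · rintro ⟨⟨a, ha, rfl⟩, hx⟩
        refine ⟨a, ?_, rfl⟩
        rw [Finset.mem_range] at ha ⊢
        by_contra hai
        rcases eq_or_lt_of_le (not_lt.1 hai) with h5 | h5
        · subst h5; omega
        · have := ell_anti N μ i a h5 ha
          omega
      · rintro ⟨a, ha, rfl⟩
        rw [Finset.mem_range] at ha
        exact ⟨⟨a, Finset.mem_range.2 (by omega), rfl⟩, ell_anti N μ a i ha hiN⟩
    have hAc : ((LL N K P).filter fun x => ell N μ i < x).card = i := by
      rw [hA, Finset.card_image_of_injOn, Finset.card_range]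
      refine (ell_injOn N μ).mono ?_
      rw [Finset.coe_subset]
      intro a ha
      rw [Finset.mem_range] at ha ⊢
      omega
    have hB : (P.filter fun y => y < K - ell N μ i) = (Finset.range j).image (yy N μ) := by
      ext y
      rw [Finset.mem_filter, Finset.mem_image, ← hj]
      constructor
      · rintro ⟨h3, h4⟩
        have h5 : y ∉ Lmu N μ := by
          rw [hL, hmem]
          have := hPN _ h3
          rintro (h6 | h6)
          · exact h6.2 h3
          · have := hPN _ h6.2
            omega
        obtain ⟨a, rfl⟩ := hole_exists N μ h y h5
        exact ⟨a, Finset.mem_range.2 ((yy_smono N μ h).lt_iff_lt.1 h4), rfl⟩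
      · rintro ⟨a, ha, rfl⟩
        rw [Finset.mem_range] at ha
        have h3 := yy_mono N μ h a j ha
        refine ⟨?_, h3⟩
        have h4 := yy_notMem N μ h a
        rw [hL, hmem] at h4
        have h5 := hPN _ h1.2
        rw [← hj] at h5
        by_contra h6
        exact h4 (Or.inl ⟨by omega, h6⟩)
    have hBc : (P.filter fun y => y < K - ell N μ i).card = j := by
      rw [hB, Finset.card_image_of_injective _ (yy_smono N μ h).injective, Finset.card_range]
    have hAB : (P.filter fun y => y < K - ell N μ i).card = ((LL N K P).filter fun x => ell N μ i < x).card := by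
      refine Finset.card_bij (fun y _ => K - y) ?_ ?_ ?_
      · intro y hy
        rw [Finset.mem_filter] at hy ⊢
        have := hPN _ hy.1
        refine ⟨(hmem _).2 (Or.inr ⟨by omega, ?_⟩), by omega⟩
        rw [Nat.sub_sub_self (by omega)]
        exact hy.1
      · intro a ha b hb hab
        rw [Finset.mem_filter] at ha hb
        have := hPN _ ha.1
        have := hPN _ hb.1
        omega
      · intro x hx
        rw [Finset.mem_filter, hmem] at hx
        obtain ⟨h3 | h3, h4⟩ := hx
        · omega
        · exact ⟨K - x, by rw [Finset.mem_filter]; exact ⟨h3.2, by omega⟩, by omega⟩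
    have hij : i = j := by omega
    subst hij
    unfold ell yy at hj
    unfold ell at h1
    omega
  · ext y
    rw [Pmu, hL, Finset.mem_sdiff, Finset.mem_range, hmem]
    constructor
    · rintro ⟨h1, h2⟩
      by_contra h3
      exact h2 (Or.inl ⟨h1, h3⟩)
    · intro h1
      have := hPN _ h1
      refine ⟨this, ?_⟩
      rintro (h6 | h6)
      · exact h6.2 h1
      · have := hPN _ h6.2
        omega

theorem transpose_iff (μ : YoungDiagram) : μ.transpose = μ ↔ Diag 0 μ := by
  constructor
  · intro h i _
    have := μ.rowLen_transpose i
    rw [h] at this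
    omega
  · intro h
    have key : ∀ i j, i ≤ j → ((i, j) ∈ μ ↔ (j, i) ∈ μ) := by
      intro i j hij
      have h1 := h i
      rw [YoungDiagram.mem_iff_lt_rowLen] at h1
      rw [YoungDiagram.mem_iff_lt_rowLen, YoungDiagram.mem_iff_lt_colLen]
      have h2 := lt_col_iff_lt_row μ i i
      omega
    apply YoungDiagram.ext
    ext ⟨i, j⟩
    rw [YoungDiagram.mem_cells, YoungDiagram.mem_cells, YoungDiagram.mem_transpose]
    show (j, i) ∈ μ ↔ (i, j) ∈ μ
    rcases le_total i j with hij | hij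
    · exact (key i j hij).symm
    · exact key j i hij

end HF

namespace HF

/-- admissibility of a set of missing beads -/
def Adm (t n N K : ℕ) (P : Finset ℕ) : Prop :=
  ∑ x ∈ LL N K P, (x : ℤ) - ∑ k ∈ Finset.range N, (k : ℤ) = t * n ∧ (HH t (LL N K P)).card = n

instance (t n N K : ℕ) : DecidablePred (Adm t n N K) := fun _ => by unfold Adm; infer_instance

theorem alg_sum (t n N K : ℕ) (ht : 0 < t) (hn : 0 < n) (hN : N = t * n) (hK : 2 * N ≤ K + 1) (hK2 : K ≤ 2 * N)
    (hpar : (2 : ℤ) ∣ (K : ℤ) - t) :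
    ∑ P ∈ (Finset.range N).powerset.filter (Adm t n N K),
      (-1 : ℚ) ^ P.card * ∏ p ∈ HH t (LL N K P), (t : ℚ) / (((p.1 : ℚ) - (p.2 : ℚ)) * eps K p) =
    eCoeff ((t : ℚ) / 2) n := by
  rw [← FM_coeff t n N K ht hn hN (by omega) (by omega) hpar, FM_expand, map_sum, Finset.sum_filter]
  symm
  refine Finset.sum_bij (fun s _ => s.map Fin.valEmbedding) ?_ ?_ ?_ ?_
  · intro s _
    rw [Finset.mem_powerset]
    intro x hx
    rw [Finset.mem_map] at hx
    obtain ⟨a, _, rfl⟩ := hx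
    exact Finset.mem_range.2 a.2
  · intro a _ b _ h
    exact Finset.map_injective _ h
  · intro P hP
    rw [Finset.mem_powerset] at hP
    refine ⟨Finset.univ.filter fun l : Fin N => (l : ℕ) ∈ P, Finset.mem_univ _, ?_⟩
    ext x
    simp only [Finset.mem_map, Finset.mem_filter, Finset.mem_univ, true_and, Fin.valEmbedding_apply]
    constructor
    · rintro ⟨a, ha, rfl⟩
      exact ha
    · intro hx
      exact ⟨⟨x, Finset.mem_range.1 (hP hx)⟩, hx, rfl⟩
  · intro s _
    have hPN : ∀ l ∈ s.map Fin.valEmbedding, l < N := by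
      intro x hx
      rw [Finset.mem_map] at hx
      obtain ⟨a, _, rfl⟩ := hx
      exact a.2
    have h1 := term_eval t n N K n ht (by rw [hN, mul_comm]) hK hK2 (s.map Fin.valEmbedding) hPN
    have h2 : (Matrix.of fun l k : Fin N => hh t ((if l ∈ s then (K : ℤ) - (l : ℕ) else (l : ℕ)) - (k : ℕ))) =
        (Matrix.of fun l k : Fin N => hh t ((gg K (s.map Fin.valEmbedding) l : ℤ) - ((k : ℕ) : ℤ))) := by
      ext l k : 2
      simp only [Matrix.of_apply]
      have h3 : (l : ℕ) ∈ s.map Fin.valEmbedding ↔ l ∈ s := by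
        rw [← Fin.valEmbedding_apply, Finset.mem_map']
      congr 2
      unfold gg
      simp only [h3]
      split_ifs
      · have := l.2
        omega
      · rfl
    rw [h2]
    have h4 : ((-1 : PowerSeries ℚ) ^ s.card) = C ((-1 : ℚ) ^ s.card) := by
      rw [map_pow, map_neg, map_one]
    rw [h4, coeff_C_mul, h1, Finset.card_map]
    by_cases h5 : Adm t n N K (s.map Fin.valEmbedding)
    · have h6 := h5
      unfold Adm at h6
      rw [if_pos h5, if_pos h6]
    · have h6 := h5
      unfold Adm at h6
      rw [if_neg h5, if_neg h6, mul_zero]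

theorem main_sum (t n N e K : ℕ) (ht : 0 < t) (hn : 0 < n) (hN : N = t * n) (he : e ≤ 1)
    (hK : K + 1 = 2 * N + e) (hpar : (2 : ℤ) ∣ (K : ℤ) - t) (Q : YoungDiagram → Prop)
    (hQ : ∀ μ, Q μ ↔ Diag e μ) :
    (∑ᶠ μ : {μ : YoungDiagram // Q μ ∧ μ.card = t * n ∧
        (μ.cells.filter fun c => t ∣ hookLen μ c).card = n},
      ((-1 : ℚ) ^ durfee μ.1 *
        ∏ c ∈ μ.1.cells.filter (fun c => t ∣ hookLen μ.1 c),
          ((t : ℚ) / ((hookLen μ.1 c : ℚ) * epsQ c)))) = eCoeff ((t : ℚ) / 2) n := by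
  rw [← alg_sum t n N K ht hn hN (by omega) (by omega) hpar]
  have hcol : ∀ μ : YoungDiagram, μ.card = t * n → μ.colLen 0 ≤ N := by
    intro μ hμ
    rw [hN, ← hμ, YoungDiagram.colLen_eq_card]
    exact Finset.card_le_card (Finset.filter_subset _ _)
  have hHc : ∀ μ : YoungDiagram, μ.colLen 0 ≤ N →
      (HH t (Lmu N μ)).card = (μ.cells.filter fun c => t ∣ hookLen μ c).card := by
    intro μ hμ
    rw [hook_bij hμ t, Finset.card_image_of_injOn]
    exact (hook_inj hμ).mono (Finset.coe_subset.2 (Finset.filter_subset _ _))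
  let S := (Finset.range N).powerset.filter (Adm t n N K)
  let E : {μ : YoungDiagram // Q μ ∧ μ.card = t * n ∧
        (μ.cells.filter fun c => t ∣ hookLen μ c).card = n} → {P // P ∈ S} := fun μ =>
    ⟨Pmu N μ.1, by
      have h0 := hcol μ.1 μ.2.2.1
      have hL := LL_Pmu h0 ((hQ _).1 μ.2.1) K hK
      simp only [S, Finset.mem_filter, Finset.mem_powerset]
      refine ⟨Finset.sdiff_subset, ?_⟩
      unfold Adm
      rw [hL, card_mu h0, hHc _ h0, μ.2.2.1, μ.2.2.2]
      exact ⟨by push_cast; rfl, rfl⟩⟩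
  have hE : Function.Bijective E := by
    constructor
    · intro μ ν h
      have h1 : Pmu N μ.1 = Pmu N ν.1 := congrArg Subtype.val h
      have hμ := hcol μ.1 μ.2.2.1
      have hν := hcol ν.1 ν.2.2.1
      apply Subtype.ext
      apply mu_ext N _ _ hμ hν
      rw [← LL_Pmu hμ ((hQ _).1 μ.2.1) K hK, ← LL_Pmu hν ((hQ _).1 ν.2.1) K hK, h1]
    · rintro ⟨P, hP⟩
      have hP' := hP
      simp only [S, Finset.mem_filter, Finset.mem_powerset] at hP'
      obtain ⟨h1, h2⟩ := hP'
      obtain ⟨μ, h0, hD, hPm⟩ := exists_diag N e K hK P (fun l hl => Finset.mem_range.1 (h1 hl))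
      subst hPm
      unfold Adm at h2
      rw [LL_Pmu h0 hD K hK, card_mu h0, hHc _ h0] at h2
      exact ⟨⟨μ, (hQ μ).2 hD, by exact_mod_cast h2.1, h2.2⟩, rfl⟩
  rw [finsum_eq_of_bijective (g := fun P : {P // P ∈ S} => (-1 : ℚ) ^ P.1.card *
    ∏ p ∈ HH t (LL N K P.1), (t : ℚ) / (((p.1 : ℚ) - (p.2 : ℚ)) * eps K p)) E hE]
  · rw [finsum_eq_sum_of_fintype]
    exact Finset.sum_coe_sort S (fun P => (-1 : ℚ) ^ P.card *
      ∏ p ∈ HH t (LL N K P), (t : ℚ) / (((p.1 : ℚ) - (p.2 : ℚ)) * eps K p))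
  · intro μ
    have h0 := hcol μ.1 μ.2.2.1
    have hD := (hQ _).1 μ.2.1
    show _ = (-1 : ℚ) ^ (Pmu N μ.1).card * ∏ p ∈ HH t (LL N K (Pmu N μ.1)), (t : ℚ) / (((p.1 : ℚ) - (p.2 : ℚ)) * eps K p)
    rw [Pmu_card h0, LL_Pmu h0 hD K hK, hook_bij h0 t, Finset.prod_image
      ((hook_inj h0).mono (Finset.coe_subset.2 (Finset.filter_subset _ _)))]
    congr 1
    refine Finset.prod_congr rfl fun c hc => ?_
    rw [Finset.mem_filter, YoungDiagram.mem_cells] at hc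
    rw [eps_eq h0 hD K hK c hc.1]
    obtain ⟨h1, h2⟩ := cell_gt N μ.1 h0 c.1 c.2 (YoungDiagram.mem_iff_lt_rowLen.1 hc.1)
    have h3 : (hookLen μ.1 c : ℚ) = (ell N μ.1 c.1 : ℚ) - (yy N μ.1 c.2 : ℚ) := by
      rw [← Nat.cast_sub h1.le, h2]
    rw [h3]

end HF

theorem hook_formula_coefficients (n : ℕ) (hn : 0 < n) :
    (∀ t' : ℕ, 0 < t' →
      ∑ᶠ μ : {μ : YoungDiagram // DDiagram μ ∧ μ.card = (2 * t') * n ∧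
          (μ.cells.filter fun c => (2 * t') ∣ hookLen μ c).card = n},
        ((-1 : ℚ) ^ durfee μ.1 *
          ∏ c ∈ μ.1.cells.filter (fun c => (2 * t') ∣ hookLen μ.1 c),
            ((2 * t' : ℕ) / ((hookLen μ.1 c : ℚ) * epsQ c)))
      = PowerSeries.coeff (t' * n)
          (pexpQ (- X ^ t' -
            PowerSeries.C (((2 * t' : ℕ) : ℚ) / 2) * X ^ (2 * t')))) ∧
    (∀ t' : ℕ,
      ∑ᶠ μ : {μ : YoungDiagram // μ.transpose = μ ∧ μ.card = (2 * t' + 1) * n ∧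
          (μ.cells.filter fun c => (2 * t' + 1) ∣ hookLen μ c).card = n},
        ((-1 : ℚ) ^ durfee μ.1 *
          ∏ c ∈ μ.1.cells.filter (fun c => (2 * t' + 1) ∣ hookLen μ.1 c),
            ((2 * t' + 1 : ℕ) / ((hookLen μ.1 c : ℚ) * epsQ c)))
      = PowerSeries.coeff ((2 * t' + 1) * n)
          (pexpQ (- X ^ (2 * t' + 1) -
            PowerSeries.C (((2 * t' + 1 : ℕ) : ℚ) / 2) * X ^ (2 * (2 * t' + 1))))) := by
  refine ⟨fun t' ht' => ?_, fun t' => ?_⟩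
  · refine Eq.trans ?_ (HF.pexp_expand t' ht' _ n).symm
    exact HF.main_sum (2 * t') n (2 * t' * n) 1 (2 * (2 * t' * n)) (by omega) hn rfl le_rfl
      (by omega) (by push_cast; exact ⟨2 * t' * n - t', by ring⟩) DDiagram (fun _ => Iff.rfl)
  · refine Eq.trans ?_ (HF.pexp_expand (2 * t' + 1) (by omega) _ n).symm
    have hp : 0 < (2 * t' + 1) * n := by positivity
    exact HF.main_sum (2 * t' + 1) n ((2 * t' + 1) * n) 0 (2 * ((2 * t' + 1) * n) - 1) (by omega) hn rfl
      (by omega) (by omega)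
      (by
        generalize (2 * t' + 1) * n = m at hp
        omega) (fun μ => μ.transpose = μ) HF.transpose_iff
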